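/- Let (Λ,η) be a special isothermic surface in S³ of type d ∈ ℕ with respect to a polynomial conserved quantity p(t), which is not a special isothermic surface of type d−1, and let (Λ₁,η₁), (Λ₂,η₂) be Darboux transforms of (Λ,η) with distinct parameters m₁ ≠ m₂ and Λ₁ ∩ Λ₂ = {0}. If (Λ₁,η₁) and (Λ₂,η₂) are special isothermic surfaces of type d with respect to polynomial conserved quantities p₁(t), p₂(t) with p₁(0) = p₂(0) = p(0), then the Bianchi permutability fourth surface (Λ̂,η̂) is a special isothermic surface of type d with respect to a polynomial conserved quantity p̂(t) satisfying p̂(0) = p(0) and (p̂(t),p̂(t)) = (p(t),p(t)) as polynomials in t. -/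

import Mathlib

noncomputable section

open Finset

/-- Minkowski space `ℝ^{n+1,1}`, modelled on `Fin (n+2) → ℝ`. -/
abbrev MV (n : ℕ) : Type := EuclideanSpace ℝ (Fin (n + 2))

/-- The Minkowski inner product of signature `(n+1,1)`. -/
def mink (n : ℕ) (x y : MV n) : ℝ :=
  ∑ i : Fin (n + 1), x i.castSucc * y i.castSucc
    - x (Fin.last (n + 1)) * y (Fin.last (n + 1))

/-- The light cone `L ⊂ ℝ^{n+1,1}`. -/
def LightCone (n : ℕ) : Set (MV n) := {v | v ≠ 0 ∧ mink n v v = 0}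

/-- The skew endomorphism `u ∧ v`, acting by `(u ∧ v) w = (u,w)v − (v,w)u`. -/
def wedge (n : ℕ) (u v w : MV n) : MV n :=
  mink n u w • v - mink n v w • u

/-- The surface domain: a two-dimensional coordinate chart. -/
abbrev Surf : Type := ℝ × ℝ

/-- the coordinate direction ∂/∂u -/
def du : Surf := (1, 0)

/-- the coordinate direction ∂/∂v -/
def dv : Surf := (0, 1)

/-- partial derivative of a section in a coordinate direction -/
def pd {n : ℕ} (e : Surf) (f : Surf → MV n) (x : Surf) : MV n :=
  fderiv ℝ f x e

lemma mink_add_left (n : ℕ) (a b c : MV n) :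
    mink n (a + b) c = mink n a c + mink n b c := by
  simp [mink, PiLp.add_apply, add_mul, Finset.sum_add_distrib]; ring

lemma mink_smul_left (n : ℕ) (r : ℝ) (a c : MV n) :
    mink n (r • a) c = r * mink n a c := by
  simp [mink, PiLp.smul_apply, smul_eq_mul, mul_sub, Finset.mul_sum, mul_assoc]

lemma mink_zero_left (n : ℕ) (c : MV n) : mink n 0 c = 0 := by
  simp [mink]

/-- An isothermic surface `(Λ,η)` in `S^n = P(L)`, given by a nowhere-zero null
lift `F` of the immersion `Λ` together with the 1-form
`η = F ∧ W₁ du + F ∧ W₂ dv` with values in `Λ ∧ Λ^⊥`. -/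
structure IsothermicSurface (n : ℕ) : Type where
  F : Surf → MV n
  W₁ : Surf → MV n
  W₂ : Surf → MV n
  smooth_F : ContDiff ℝ (⊤ : ℕ∞) F
  smooth_W₁ : ContDiff ℝ (⊤ : ℕ∞) W₁
  smooth_W₂ : ContDiff ℝ (⊤ : ℕ∞) W₂
  F_ne : ∀ x, F x ≠ 0
  F_null : ∀ x, mink n (F x) (F x) = 0
  immersed : ∀ x, LinearIndependent ℝ ![F x, pd du F x, pd dv F x]
  W₁_perp : ∀ x, mink n (F x) (W₁ x) = 0
  W₂_perp : ∀ x, mink n (F x) (W₂ x) = 0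
  eta_ne : ∃ x z, wedge n (F x) (W₁ x) z ≠ 0 ∨ wedge n (F x) (W₂ x) z ≠ 0
  eta_closed : ∀ x z,
    fderiv ℝ (fun y => wedge n (F y) (W₂ y) z) x du
      = fderiv ℝ (fun y => wedge n (F y) (W₁ y) z) x dv

/-- `s` is a parallel section for the flat connection `∇^t = d + tη`. -/
def ParallelSection (n : ℕ) (S : IsothermicSurface n) (t : ℝ)
    (s : Surf → MV n) : Prop :=
  ∀ x, fderiv ℝ s x du + t • wedge n (S.F x) (S.W₁ x) (s x) = 0
     ∧ fderiv ℝ s x dv + t • wedge n (S.F x) (S.W₂ x) (s x) = 0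

/-- A polynomial conserved quantity of degree `d` of the isothermic surface
`(Λ,η)`: a polynomial `p(t) = Σ_{k=0}^d p_k t^k` of (smooth) sections, of exact
degree `d`, with `∇^t p(t) = 0` for all `t`. -/
structure PolyConservedQuantity (n : ℕ) (S : IsothermicSurface n) (d : ℕ) : Type where
  coeff : ℕ → Surf → MV n
  smooth : ∀ k, ContDiff ℝ (⊤ : ℕ∞) (coeff k)
  coeff_eq_zero : ∀ k, d < k → coeff k = 0
  top_ne : coeff d ≠ 0
  conserved : ∀ t : ℝ, ParallelSection n S t
    (fun x => ∑ k ∈ Finset.range (d + 1), t ^ k • coeff k x)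

/-- evaluation `p(t)` of a polynomial conserved quantity -/
def pcEval {n : ℕ} {S : IsothermicSurface n} {d : ℕ}
    (p : PolyConservedQuantity n S d) (t : ℝ) (x : Surf) : MV n :=
  ∑ k ∈ Finset.range (d + 1), t ^ k • p.coeff k x

/-- `(Λ,η)` is a special isothermic surface of type `d`. -/
def SpecialOfType (n : ℕ) (S : IsothermicSurface n) (d : ℕ) : Prop :=
  Nonempty (PolyConservedQuantity n S d)

/-- `p₀ ∈ ⟨w⟩`: the polynomial conserved quantity exhibits `(Λ,η)` as special
isothermic in the space-form `E(w)`. -/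
def InSpaceForm {n : ℕ} {S : IsothermicSurface n} {d : ℕ}
    (p : PolyConservedQuantity n S d) (w : MV n) : Prop :=
  ∃ c : ℝ, ∀ x, p.coeff 0 x = c • w

/-- fullness: the image of `Λ` lies in no proper subsphere -/
def Full (n : ℕ) (S : IsothermicSurface n) : Prop :=
  ¬ ∃ p : MV n, p ≠ 0 ∧ ∀ x, mink n p (S.F x) = 0
/-- A Darboux transform `Λ̂` of `(Λ,η)` with parameter `m`, given by a
`∇^m`-parallel null lift `G` spanning an immersed surface with `Λ̂ ∩ Λ = 0`. -/
structure DarbouxTransform (n : ℕ) (S : IsothermicSurface n) (m : ℝ) : Type where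
  G : Surf → MV n
  smooth_G : ContDiff ℝ (⊤ : ℕ∞) G
  G_ne : ∀ x, G x ≠ 0
  G_null : ∀ x, mink n (G x) (G x) = 0
  immersed : ∀ x, LinearIndependent ℝ ![G x, pd du G x, pd dv G x]
  disjoint : ∀ x, G x ∉ Submodule.span ℝ {S.F x}
  parallel : ParallelSection n S m G

/-- The gauge transformation `Γ_{⟨F⟩}^{⟨G⟩}(c)`: acts as `c` on `⟨G⟩`, as `1` on
`(⟨F⟩ ⊕ ⟨G⟩)^⊥` and as `c⁻¹` on `⟨F⟩`. -/
def gaugeG (n : ℕ) (F G : MV n) (c : ℝ) (z : MV n) : MV n :=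
  ((mink n G z / mink n F G) / c) • F
    + (c * (mink n F z / mink n F G)) • G
    + (z - (mink n G z / mink n F G) • F - (mink n F z / mink n F G) • G)

/-- `Γ_Λ^{Λ̂}(1 − t/m) · (d + tη) = d + tη̂` for all `t ≠ m`: the gauge relation
between the pencils of flat connections of an isothermic surface `S` and of (an
isothermic structure `T` on) its Darboux transform with parameter `m`. -/
def GaugeRel (n : ℕ) (S T : IsothermicSurface n) (m : ℝ) : Prop :=
  ∀ t : ℝ, t ≠ m → ∀ s : Surf → MV n, ContDiff ℝ (⊤ : ℕ∞) s → ∀ x : Surf,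
    (fderiv ℝ (fun y => gaugeG n (S.F y) (T.F y) (1 - t / m) (s y)) x du
        + t • wedge n (T.F x) (T.W₁ x) (gaugeG n (S.F x) (T.F x) (1 - t / m) (s x))
      = gaugeG n (S.F x) (T.F x) (1 - t / m)
          (fderiv ℝ s x du + t • wedge n (S.F x) (S.W₁ x) (s x)))
    ∧ (fderiv ℝ (fun y => gaugeG n (S.F y) (T.F y) (1 - t / m) (s y)) x dv
        + t • wedge n (T.F x) (T.W₂ x) (gaugeG n (S.F x) (T.F x) (1 - t / m) (s x))
      = gaugeG n (S.F x) (T.F x) (1 - t / m)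
          (fderiv ℝ s x dv + t • wedge n (S.F x) (S.W₂ x) (s x)))

/-- `Λ̂ = ⟨p(m)⟩` with `(p(m),p(m)) = 0`: the Darboux transform `D` is a
complementary surface of `(Λ,η)` with respect to `p(t)`. -/
def IsComplementary (n : ℕ) {S : IsothermicSurface n} {d : ℕ}
    (p : PolyConservedQuantity n S d) {m : ℝ} (D : DarbouxTransform n S m) : Prop :=
  (∀ x, mink n (pcEval p m x) (pcEval p m x) = 0) ∧
  (∀ x, Submodule.span ℝ {D.G x} = Submodule.span ℝ {pcEval p m x})

/-- `m` is a repeated root of the (constant-coefficient) polynomial `(p(t),p(t))`. -/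
def IsRepeatedRootAt {n : ℕ} {S : IsothermicSurface n} {d : ℕ}
    (p : PolyConservedQuantity n S d) (m : ℝ) : Prop :=
  ∀ x, mink n (pcEval p m x) (pcEval p m x) = 0
    ∧ deriv (fun t : ℝ => mink n (pcEval p t x) (pcEval p t x)) m = 0
/-- metric coefficient `g₁₁ = (F_u,F_u)` of the induced metric -/
def gUU (n : ℕ) (F : Surf → MV n) (x : Surf) : ℝ := mink n (pd du F x) (pd du F x)

/-- metric coefficient `g₁₂ = (F_u,F_v)` -/
def gUV (n : ℕ) (F : Surf → MV n) (x : Surf) : ℝ := mink n (pd du F x) (pd dv F x)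

/-- metric coefficient `g₂₂ = (F_v,F_v)` -/
def gVV (n : ℕ) (F : Surf → MV n) (x : Surf) : ℝ := mink n (pd dv F x) (pd dv F x)

/-- `(𝐇, N)`, the inner product of the mean curvature vector of `F` (in a
space-form `E(w)`) with a normal field `N`: half the trace with respect to the
induced metric of the `N`-component of the second fundamental form. -/
def meanCurv (n : ℕ) (F N : Surf → MV n) (x : Surf) : ℝ :=
  (gVV n F x * mink n (pd du (pd du F) x) (N x)
    - 2 * gUV n F x * mink n (pd du (pd dv F) x) (N x)
    + gUU n F x * mink n (pd dv (pd dv F) x) (N x))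
  / (2 * (gUU n F x * gVV n F x - gUV n F x ^ 2))

/-- `N` is a unit normal field of the lift `F : Σ → E(w)`. -/
def IsUnitNormal (n : ℕ) (F N : Surf → MV n) (w : MV n) : Prop :=
  (∀ x, mink n (N x) (N x) = 1) ∧ (∀ x, mink n (N x) w = 0)
    ∧ (∀ x, mink n (N x) (F x) = 0)
    ∧ (∀ x, mink n (N x) (pd du F x) = 0) ∧ (∀ x, mink n (N x) (pd dv F x) = 0)

/-- `N` is parallel for the normal connection of `F : Σ → E(w)`: the derivative
of `N` has no component in the normal bundle of `F` in `E(w)`. -/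
def ParallelNormal (n : ℕ) (F N : Surf → MV n) (w : MV n) : Prop :=
  ∀ x e, fderiv ℝ N x e ∈ Submodule.span ℝ {F x, pd du F x, pd dv F x, w}

/-- the chart coordinates `(u,v)` are conformal curvature line coordinates
corresponding to `η`, with conformal factor `e^{2θ}`:
`I = e^{2θ}(du² + dv²)` and `η = e^{−2θ} F ∧ (−F_u du + F_v dv)`. -/
def ConformalCoords (n : ℕ) (S : IsothermicSurface n) (θ : Surf → ℝ) : Prop :=
  ContDiff ℝ (⊤ : ℕ∞) θ
  ∧ (∀ x, mink n (pd du S.F x) (pd du S.F x) = Real.exp (2 * θ x))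
  ∧ (∀ x, mink n (pd dv S.F x) (pd dv S.F x) = Real.exp (2 * θ x))
  ∧ (∀ x, mink n (pd du S.F x) (pd dv S.F x) = 0)
  ∧ (∀ x z, wedge n (S.F x) (S.W₁ x) z
      = Real.exp (-(2 * θ x)) • wedge n (S.F x) (-pd du S.F x) z)
  ∧ (∀ x z, wedge n (S.F x) (S.W₂ x) z
      = Real.exp (-(2 * θ x)) • wedge n (S.F x) (pd dv S.F x) z)

/-- the second fundamental form of the lift `F` in `E(w)` with respect to the
unit normal `N` is `II = e^{2θ}(k₁ du² + k₂ dv²)`. -/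
def PrincipalCurvatures (n : ℕ) (S : IsothermicSurface n) (N : Surf → MV n)
    (θ k₁ k₂ : Surf → ℝ) : Prop :=
  (∀ x, mink n (pd du (pd du S.F) x) (N x) = Real.exp (2 * θ x) * k₁ x)
  ∧ (∀ x, mink n (pd du (pd dv S.F) x) (N x) = 0)
  ∧ (∀ x, mink n (pd dv (pd dv S.F) x) (N x) = Real.exp (2 * θ x) * k₂ x)

/-- partial derivative of a real function on the surface -/
def pdR (e : Surf) (f : Surf → ℝ) (x : Surf) : ℝ := fderiv ℝ f x e
/-- `(Λ^c, η^c)` is the Christoffel transform of `(Λ,η)` with respect to the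
pair `(v∞, v₀)`, witnessed by the stereoprojections `f`, `f^c` into
`ℝ^n = ⟨v₀,v∞⟩^⊥`:  `F = exp(f ∧ v∞)v₀`, `F^c = exp(f^c ∧ v₀)v∞`,
`η = Ad(exp(f ∧ v∞))(df^c ∧ v₀)` and `η^c = Ad(exp(f^c ∧ v₀))(df ∧ v∞)`. -/
def IsChristoffelPair (n : ℕ) (S Sc : IsothermicSurface n) (vinf v0 : MV n)
    (f fc : Surf → MV n) : Prop :=
  vinf ∈ LightCone n ∧ v0 ∈ LightCone n ∧ mink n v0 vinf = -1
  ∧ ContDiff ℝ (⊤ : ℕ∞) f ∧ ContDiff ℝ (⊤ : ℕ∞) fc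
  ∧ (∀ x, mink n (f x) v0 = 0) ∧ (∀ x, mink n (f x) vinf = 0)
  ∧ (∀ x, mink n (fc x) v0 = 0) ∧ (∀ x, mink n (fc x) vinf = 0)
  ∧ (∀ x, S.F x = v0 + f x + (mink n (f x) (f x) / 2) • vinf)
  ∧ (∀ x, Sc.F x = vinf + fc x + (mink n (fc x) (fc x) / 2) • v0)
  ∧ (∀ x z, wedge n (S.F x) (S.W₁ x) z
      = wedge n (pd du fc x + mink n (f x) (pd du fc x) • vinf) (S.F x) z)
  ∧ (∀ x z, wedge n (S.F x) (S.W₂ x) z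
      = wedge n (pd dv fc x + mink n (f x) (pd dv fc x) • vinf) (S.F x) z)
  ∧ (∀ x z, wedge n (Sc.F x) (Sc.W₁ x) z
      = wedge n (pd du f x + mink n (fc x) (pd du f x) • v0) (Sc.F x) z)
  ∧ (∀ x z, wedge n (Sc.F x) (Sc.W₂ x) z
      = wedge n (pd dv f x + mink n (fc x) (pd dv f x) • v0) (Sc.F x) z)

/-- `Φ` is an orthogonal gauge transformation with `Φ · (d + sη) = d`. -/
def IsTGauge (n : ℕ) (S : IsothermicSurface n) (s : ℝ)
    (Φ : Surf → MV n → MV n) : Prop :=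
  (∀ x, IsLinearMap ℝ (Φ x))
  ∧ (∀ x z z', mink n (Φ x z) (Φ x z') = mink n z z')
  ∧ (∀ σ : Surf → MV n, ContDiff ℝ (⊤ : ℕ∞) σ → ∀ x,
      (fderiv ℝ (fun y => Φ y (σ y)) x du
         = Φ x (fderiv ℝ σ x du + s • wedge n (S.F x) (S.W₁ x) (σ x)))
      ∧ (fderiv ℝ (fun y => Φ y (σ y)) x dv
         = Φ x (fderiv ℝ σ x dv + s • wedge n (S.F x) (S.W₂ x) (σ x))))

/-- `(Λ_s, η_s)` is the T-transform of `(Λ,η)` associated to `Φ_s`: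
`Λ_s = Φ_s Λ` and `η_s = Ad(Φ_s) η`. -/
def IsTTransform (n : ℕ) (S : IsothermicSurface n) (s : ℝ)
    (Φ : Surf → MV n → MV n) (Ss : IsothermicSurface n) : Prop :=
  IsTGauge n S s Φ
  ∧ (∀ x, Ss.F x = Φ x (S.F x))
  ∧ (∀ x z, wedge n (Ss.F x) (Ss.W₁ x) (Φ x z) = Φ x (wedge n (S.F x) (S.W₁ x) z))
  ∧ (∀ x z, wedge n (Ss.F x) (Ss.W₂ x) (Φ x z) = Φ x (wedge n (S.F x) (S.W₂ x) z))

/-- orthogonal complement with respect to the Minkowski form -/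
def mperp (n : ℕ) (U : Submodule ℝ (MV n)) : Submodule ℝ (MV n) where
  carrier := {v | ∀ u ∈ U, mink n v u = 0}
  add_mem' := by
    intro a b ha hb u hu
    rw [mink_add_left, ha u hu, hb u hu, add_zero]
  zero_mem' := by
    intro u hu; exact mink_zero_left n u
  smul_mem' := by
    intro r a ha u hu
    rw [mink_smul_left, ha u hu, mul_zero]

/-- the spherical system of `Λ` and a Darboux transform `Λ̂ = ⟨G⟩`: the
`(n−2)`-sphere congruence `C = Λ ⊕ Λ̂ ⊕ V_R^⊥`, `V_R = Λ^{(1)} ⊕ Λ̂`. -/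
def sphericalSystem (n : ℕ) (S : IsothermicSurface n) (G : Surf → MV n)
    (x : Surf) : Submodule ℝ (MV n) :=
  Submodule.span ℝ {S.F x, G x}
    ⊔ mperp n (Submodule.span ℝ {S.F x, pd du S.F x, pd dv S.F x, G x})

/-- the sphere-planes congruence `P = C + ⟨w⟩` of `Λ` and `Λ̂ = ⟨G⟩` with
respect to `w`. -/
def spherePlanes (n : ℕ) (S : IsothermicSurface n) (G : Surf → MV n)
    (w : MV n) (x : Surf) : Submodule ℝ (MV n) :=
  sphericalSystem n S G x ⊔ Submodule.span ℝ {w}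
/-- the lift `Γ_Λ^{Λ₁}(1 − m₂/m₁)(G₂)` of the Bianchi permutability fourth
surface `Λ̂` -/
def permutLift (n : ℕ) (S : IsothermicSurface n) (m₁ m₂ : ℝ)
    (D₁ : DarbouxTransform n S m₁) (D₂ : DarbouxTransform n S m₂) :
    Surf → MV n :=
  fun x => gaugeG n (S.F x) (D₁.G x) (1 - m₂ / m₁) (D₂.G x)

/-- `T` is the Bianchi permutability fourth surface
`Λ̂ = Γ_Λ^{Λ₁}(1 − m₂/m₁)(Λ₂)` with `η̂ = Ad(Γ_{Λ₂}^{Λ₁}(m₂/m₁)) η`. -/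
def IsPermutabilityFourth (n : ℕ) (S : IsothermicSurface n) (m₁ m₂ : ℝ)
    (D₁ : DarbouxTransform n S m₁) (D₂ : DarbouxTransform n S m₂)
    (T : IsothermicSurface n) : Prop :=
  (∀ x, T.F x = permutLift n S m₁ m₂ D₁ D₂ x)
  ∧ (∀ x z, wedge n (T.F x) (T.W₁ x) (gaugeG n (D₂.G x) (D₁.G x) (m₂ / m₁) z)
      = gaugeG n (D₂.G x) (D₁.G x) (m₂ / m₁) (wedge n (S.F x) (S.W₁ x) z))
  ∧ (∀ x z, wedge n (T.F x) (T.W₂ x) (gaugeG n (D₂.G x) (D₁.G x) (m₂ / m₁) z)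
      = gaugeG n (D₂.G x) (D₁.G x) (m₂ / m₁) (wedge n (S.F x) (S.W₂ x) z))
lemma mink_comm (n : ℕ) (a b : MV n) : mink n a b = mink n b a := by
  simp only [mink, mul_comm]

lemma mink_add_right (n : ℕ) (a b c : MV n) :
    mink n a (b + c) = mink n a b + mink n a c := by
  rw [mink_comm, mink_add_left, mink_comm n b, mink_comm n c]

lemma mink_smul_right (n : ℕ) (r : ℝ) (a c : MV n) :
    mink n a (r • c) = r * mink n a c := by
  rw [mink_comm, mink_smul_left, mink_comm n c]

lemma mink_neg_left (n : ℕ) (a b : MV n) : mink n (-a) b = -mink n a b := by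
  rw [← neg_one_smul ℝ a, mink_smul_left]; ring

lemma mink_neg_right (n : ℕ) (a b : MV n) : mink n a (-b) = -mink n a b := by
  rw [mink_comm, mink_neg_left, mink_comm]

lemma mink_sub_left (n : ℕ) (a b c : MV n) :
    mink n (a - b) c = mink n a c - mink n b c := by
  rw [sub_eq_add_neg, mink_add_left, mink_neg_left]; ring

lemma mink_sub_right (n : ℕ) (a b c : MV n) :
    mink n a (b - c) = mink n a b - mink n a c := by
  rw [sub_eq_add_neg, mink_add_right, mink_neg_right]; ring

lemma mink_zero_right (n : ℕ) (c : MV n) : mink n c 0 = 0 := by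
  simp [mink]

/-- The Minkowski inner product as a bilinear form. -/
def minkForm (n : ℕ) : LinearMap.BilinForm ℝ (MV n) :=
  LinearMap.mk₂ ℝ (mink n) (mink_add_left n) (mink_smul_left n) (mink_add_right n)
    (fun r a c => mink_smul_right n r a c)

@[simp] lemma minkForm_apply (n : ℕ) (x y : MV n) : minkForm n x y = mink n x y := rfl

lemma mink_sum_left {ι : Type*} (n : ℕ) (s : Finset ι) (f : ι → MV n) (y : MV n) :
    mink n (∑ i ∈ s, f i) y = ∑ i ∈ s, mink n (f i) y := by
  classical
  induction s using Finset.induction_on with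
  | empty => simp [mink_zero_left]
  | insert i s hi ih => simp [Finset.sum_insert hi, mink_add_left, ih]

lemma eq_zero_of_mink_eq_zero (n : ℕ) (x : MV n) (h : ∀ y, mink n x y = 0) : x = 0 := by
  ext i
  induction i using Fin.lastCases with
  | last => simpa [mink, Fin.castSucc_ne_last] using h (EuclideanSpace.single (Fin.last (n + 1)) 1)
  | cast i =>
    simpa [mink, Fin.castSucc_ne_last, (Fin.castSucc_ne_last _).symm, Pi.single_apply]
      using h (EuclideanSpace.single i.castSucc 1)

lemma minkForm_nondegenerate (n : ℕ) : (minkForm n).Nondegenerate := by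
  refine ⟨fun x h => eq_zero_of_mink_eq_zero n x h, fun x h => eq_zero_of_mink_eq_zero n x ?_⟩
  intro y
  rw [mink_comm]
  exact h y

/-- Orthogonal null vectors are proportional. -/
lemma exists_smul_of_null_of_null_of_mink_eq_zero (n : ℕ) {x y : MV n} (hx : x ≠ 0)
    (hxx : mink n x x = 0) (hyy : mink n y y = 0) (hxy : mink n x y = 0) :
    ∃ f : ℝ, y = f • x := by
  have key : ∀ w : MV n, mink n w w = 0 → w (Fin.last (n + 1)) = 0 → w = 0 := by
    intro w hw h0
    simp only [mink, h0, mul_zero, sub_zero] at hw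
    rw [Finset.sum_eq_zero_iff_of_nonneg (fun i _ => mul_self_nonneg _)] at hw
    ext i
    induction i using Fin.lastCases with
    | last => simpa using h0
    | cast i => simpa using hw i (Finset.mem_univ i)
  have hx0 : x (Fin.last (n + 1)) ≠ 0 := fun h => hx (key x hxx h)
  refine ⟨y (Fin.last (n + 1)) / x (Fin.last (n + 1)), ?_⟩
  rw [← sub_eq_zero]
  apply key
  · simp only [mink_sub_left, mink_sub_right, mink_smul_left, mink_smul_right, hxx, hyy, hxy,
      mink_comm n y x]
    ring
  · simp [hx0]

lemma mink_ne_zero_of_null (n : ℕ) {x y : MV n} (hx : x ≠ 0)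
    (hxx : mink n x x = 0) (hyy : mink n y y = 0) (h : y ∉ Submodule.span ℝ {x}) :
    mink n x y ≠ 0 := by
  intro hxy
  obtain ⟨f, rfl⟩ := exists_smul_of_null_of_null_of_mink_eq_zero n hx hxx hyy hxy
  exact h (Submodule.smul_mem _ _ (Submodule.mem_span_singleton_self x))

/-- In `ℝ^{4,1}` the complement of the span of three independent vectors, the first of them null
and orthogonal to the others, is a plane on which the form degenerates. -/
lemma gram_eq_zero {F A B u v : MV 3} (hli : LinearIndependent ℝ ![F, A, B])
    (hFF : mink 3 F F = 0) (hFA : mink 3 F A = 0) (hFB : mink 3 F B = 0)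
    (hFu : mink 3 F u = 0) (hAu : mink 3 A u = 0) (hBu : mink 3 B u = 0)
    (hFv : mink 3 F v = 0) (hAv : mink 3 A v = 0) (hBv : mink 3 B v = 0) :
    mink 3 u u * mink 3 v v = mink 3 u v ^ 2 := by
  have hF : F ≠ 0 := hli.ne_zero 0
  set V := (minkForm 3).orthogonal (Submodule.span ℝ (Set.range ![F, A, B])) with hV
  have hmem : ∀ w, mink 3 F w = 0 → mink 3 A w = 0 → mink 3 B w = 0 → w ∈ V := by
    intro w h0 h1 h2
    rw [hV, LinearMap.BilinForm.mem_orthogonal_iff]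
    intro z hz
    change minkForm 3 z w = 0
    induction hz using Submodule.span_induction with
    | mem z hz =>
      obtain ⟨i, rfl⟩ := hz
      fin_cases i <;> simpa
    | zero => simp
    | add a b _ _ ha hb => simp_all
    | smul r a _ ha => simp_all
  have hdim : Module.finrank ℝ V = 2 := by
    rw [hV, LinearMap.BilinForm.finrank_orthogonal (minkForm_nondegenerate 3),
      finrank_span_eq_card hli]
    simp
  have hdep : ¬ LinearIndependent ℝ ![F, u, v] := by
    intro hl
    have h1 := Submodule.finrank_mono (R := ℝ) (M := MV 3)
      (s := Submodule.span ℝ (Set.range ![F, u, v])) (t := V) (by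
        rw [Submodule.span_le]
        rintro _ ⟨i, rfl⟩
        fin_cases i
        · exact hmem _ hFF (by simpa [mink_comm 3 A] using hFA) (by simpa [mink_comm 3 B] using hFB)
        · exact hmem _ hFu hAu hBu
        · exact hmem _ hFv hAv hBv)
    rw [finrank_span_eq_card hl, hdim] at h1
    simp at h1
  rw [Fintype.not_linearIndependent_iff] at hdep
  obtain ⟨g, hg, i, hi⟩ := hdep
  simp only [Fin.sum_univ_three, Matrix.cons_val_zero, Matrix.cons_val_one,
    Matrix.cons_val] at hg
  have e1 : g 1 * mink 3 u u + g 2 * mink 3 u v = 0 := by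
    have := congrArg (fun z => mink 3 z u) hg
    simpa only [mink_add_left, mink_smul_left, mink_zero_left, hFu, mul_zero, zero_add,
      mink_comm 3 v u] using this
  have e2 : g 1 * mink 3 u v + g 2 * mink 3 v v = 0 := by
    have := congrArg (fun z => mink 3 z v) hg
    simpa only [mink_add_left, mink_smul_left, mink_zero_left, hFv, mul_zero, zero_add] using this
  by_cases h1 : g 1 = 0
  · by_cases h2 : g 2 = 0
    · exfalso
      rw [h1, h2] at hg
      simp only [zero_smul, add_zero, smul_eq_zero, hF, or_false] at hg
      fin_cases i <;> simp_all
    · have : mink 3 u v = 0 := by simpa [h1, h2] using e1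
      have h3 : mink 3 v v = 0 := by simpa [h1, h2] using e2
      rw [this, h3]; ring
  · apply mul_left_cancel₀ h1
    linear_combination mink 3 v v * e1 - mink 3 u v * e2

/-- The Minkowski inner product as a continuous bilinear map. -/
def minkL (n : ℕ) : MV n →L[ℝ] MV n →L[ℝ] ℝ :=
  LinearMap.toContinuousBilinearMap (minkForm n)

lemma minkL_apply (n : ℕ) (x y : MV n) : minkL n x y = mink n x y := rfl

lemma ContDiff.mink {n : ℕ} {f g : Surf → MV n} (hf : ContDiff ℝ (⊤ : ℕ∞) f)
    (hg : ContDiff ℝ (⊤ : ℕ∞) g) : ContDiff ℝ (⊤ : ℕ∞) (fun y => mink n (f y) (g y)) := by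
  simp only [← minkL_apply]
  exact ((minkL n).contDiff.comp hf).clm_apply hg

lemma fderiv_mink {n : ℕ} {f g : Surf → MV n} (hf : ContDiff ℝ (⊤ : ℕ∞) f)
    (hg : ContDiff ℝ (⊤ : ℕ∞) g) (x e : Surf) :
    fderiv ℝ (fun y => mink n (f y) (g y)) x e
      = mink n (fderiv ℝ f x e) (g x) + mink n (f x) (fderiv ℝ g x e) := by
  have h := ((minkL n).hasFDerivAt_of_bilinear
    (hf.differentiable (by simp) x).hasFDerivAt (hg.differentiable (by simp) x).hasFDerivAt).fderiv
  simp only [minkL_apply] at h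
  rw [h]
  simp [minkL_apply, add_comm]

lemma fderiv_smul_apply {n : ℕ} {c : Surf → ℝ} {f : Surf → MV n}
    (hc : ContDiff ℝ (⊤ : ℕ∞) c) (hf : ContDiff ℝ (⊤ : ℕ∞) f) (x e : Surf) :
    fderiv ℝ (fun y => c y • f y) x e = c x • fderiv ℝ f x e + fderiv ℝ c x e • f x := by
  rw [fderiv_fun_smul (hc.differentiable (by simp) x) (hf.differentiable (by simp) x)]
  simp

lemma fderiv_add_apply {n : ℕ} {f g : Surf → MV n}
    (hf : ContDiff ℝ (⊤ : ℕ∞) f) (hg : ContDiff ℝ (⊤ : ℕ∞) g) (x e : Surf) :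
    fderiv ℝ (fun y => f y + g y) x e = fderiv ℝ f x e + fderiv ℝ g x e := by
  rw [fderiv_fun_add (hf.differentiable (by simp) x) (hg.differentiable (by simp) x)]
  simp

lemma fderiv_sub_apply {n : ℕ} {f g : Surf → MV n}
    (hf : ContDiff ℝ (⊤ : ℕ∞) f) (hg : ContDiff ℝ (⊤ : ℕ∞) g) (x e : Surf) :
    fderiv ℝ (fun y => f y - g y) x e = fderiv ℝ f x e - fderiv ℝ g x e := by
  rw [fderiv_fun_sub (hf.differentiable (by simp) x) (hg.differentiable (by simp) x)]
  simp

lemma fderiv_const_smul_apply {n : ℕ} (r : ℝ) {f : Surf → MV n}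
    (hf : ContDiff ℝ (⊤ : ℕ∞) f) (x e : Surf) :
    fderiv ℝ (fun y => r • f y) x e = r • fderiv ℝ f x e := by
  rw [fderiv_fun_const_smul (hf.differentiable (by simp) x)]
  simp

lemma ContDiff.wedge {n : ℕ} {u v w : Surf → MV n} (hu : ContDiff ℝ (⊤ : ℕ∞) u)
    (hv : ContDiff ℝ (⊤ : ℕ∞) v) (hw : ContDiff ℝ (⊤ : ℕ∞) w) :
    ContDiff ℝ (⊤ : ℕ∞) (fun y => wedge n (u y) (v y) (w y)) :=
  ((hu.mink hw).smul hv).sub ((hv.mink hw).smul hu)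

lemma fderiv_wedge {n : ℕ} {u v w : Surf → MV n} (hu : ContDiff ℝ (⊤ : ℕ∞) u)
    (hv : ContDiff ℝ (⊤ : ℕ∞) v) (hw : ContDiff ℝ (⊤ : ℕ∞) w) (x e : Surf) :
    fderiv ℝ (fun y => wedge n (u y) (v y) (w y)) x e
      = wedge n (fderiv ℝ u x e) (v x) (w x) + wedge n (u x) (fderiv ℝ v x e) (w x)
        + wedge n (u x) (v x) (fderiv ℝ w x e) := by
  have h₁ : ContDiff ℝ (⊤ : ℕ∞) fun y => mink n (u y) (w y) • v y := (hu.mink hw).smul hv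
  have h₂ : ContDiff ℝ (⊤ : ℕ∞) fun y => mink n (v y) (w y) • u y := (hv.mink hw).smul hu
  simp only [_root_.wedge]
  rw [fderiv_sub_apply h₁ h₂,
    fderiv_smul_apply (hu.mink hw) hv, fderiv_smul_apply (hv.mink hw) hu,
    fderiv_mink hu hw, fderiv_mink hv hw]
  module

lemma eq_zero_of_apply_du_dv {E : Type*} [NormedAddCommGroup E] [NormedSpace ℝ E]
    {L : Surf →L[ℝ] E} (hu : L du = 0) (hv : L dv = 0) : L = 0 := by
  refine ContinuousLinearMap.ext fun y => ?_
  have hy : y = y.1 • du + y.2 • dv := by simp [du, dv]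
  rw [hy, map_add, map_smul, map_smul, hu, hv]
  simp

lemma wedge_add (n : ℕ) (u v a b : MV n) :
    wedge n u v (a + b) = wedge n u v a + wedge n u v b := by
  simp only [wedge, mink_add_right]; module

lemma wedge_smul (n : ℕ) (u v : MV n) (r : ℝ) (a : MV n) :
    wedge n u v (r • a) = r • wedge n u v a := by
  simp only [wedge, mink_smul_right]; module

lemma wedge_sub (n : ℕ) (u v a b : MV n) :
    wedge n u v (a - b) = wedge n u v a - wedge n u v b := by
  simp only [wedge, mink_sub_right]; module

lemma wedge_zero (n : ℕ) (u v : MV n) : wedge n u v 0 = 0 := by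
  simp [wedge, mink_zero_right]

/-- `u ∧ v` is skew-adjoint. -/
lemma mink_wedge_left (n : ℕ) (u v a b : MV n) :
    mink n (wedge n u v a) b = -mink n a (wedge n u v b) := by
  simp only [wedge, mink_sub_left, mink_smul_left, mink_comm n a]
  ring

lemma mink_wedge_self (n : ℕ) (u v a : MV n) : mink n (wedge n u v a) a = 0 := by
  have h := mink_wedge_left n u v a a
  rw [mink_comm n a] at h
  linarith

lemma mink_wedge_eq_zero (n : ℕ) {F W : MV n} (hF : mink n F F = 0) (hW : mink n F W = 0)
    (a : MV n) : mink n (wedge n F W a) F = 0 := by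
  simp [wedge, mink_sub_left, mink_smul_left, hF, mink_comm n W F, hW]

namespace IsothermicSurface

variable {n : ℕ} (S : IsothermicSurface n)

/-- The support of `η`, that is, the set where `η ≠ 0`. -/
def etaSupport : Set Surf :=
  {x | ∃ z, wedge n (S.F x) (S.W₁ x) z ≠ 0 ∨ wedge n (S.F x) (S.W₂ x) z ≠ 0}

lemma isOpen_etaSupport : IsOpen S.etaSupport := by
  have h : S.etaSupport = ⋃ z : MV n, ({x | wedge n (S.F x) (S.W₁ x) z ≠ 0}
      ∪ {x | wedge n (S.F x) (S.W₂ x) z ≠ 0}) := by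
    ext x; simp [etaSupport]
  rw [h]
  refine isOpen_iUnion fun z => (isOpen_ne_fun ?_ continuous_const).union
    (isOpen_ne_fun ?_ continuous_const)
  · exact (S.smooth_F.wedge S.smooth_W₁ contDiff_const).continuous
  · exact (S.smooth_F.wedge S.smooth_W₂ contDiff_const).continuous

lemma mink_fderiv_F (x e : Surf) : mink n (S.F x) (fderiv ℝ S.F x e) = 0 := by
  have h := fderiv_mink S.smooth_F S.smooth_F x e
  simp only [S.F_null] at h
  rw [mink_comm n (fderiv ℝ S.F x e)] at h
  simp at h
  linarith

lemma mink_F_eq_zero {x : Surf} (hx : x ∈ S.etaSupport) {v : MV n}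
    (h₁ : wedge n (S.F x) (S.W₁ x) v = 0) (h₂ : wedge n (S.F x) (S.W₂ x) v = 0) :
    mink n (S.F x) v = 0 := by
  by_contra hne
  have key : ∀ W : MV n, wedge n (S.F x) W v = 0 → ∀ z, wedge n (S.F x) W z = 0 := by
    intro W hW z
    have hW' : W = (mink n W v / mink n (S.F x) v) • S.F x := by
      rw [wedge, sub_eq_zero] at hW
      rw [div_eq_inv_mul, mul_smul, ← hW, smul_smul, inv_mul_cancel₀ hne, one_smul]
    rw [hW']
    simp only [wedge, mink_smul_left]
    module
  obtain ⟨z, hz | hz⟩ := hx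
  · exact hz (key _ h₁ z)
  · exact hz (key _ h₂ z)

end IsothermicSurface

/-- Pointwise incompatibility of `η` being closed with `η` being proportional to `F ∧ dF`. -/
lemma false_of_closed_of_proportional {n : ℕ} {F A B W₁ W₂ : MV n} {c f h₁ h₂ : ℝ}
    (hli : LinearIndependent ℝ ![F, A, B])
    (hFF : mink n F F = 0) (hFA : mink n F A = 0)
    (hf : f ≠ 0) (hW₁ : c • W₁ = h₁ • F - f • A) (hW₂ : c • W₂ = h₂ • F - f • B)
    (hcl : ∃ k : ℝ, wedge n A W₂ A - wedge n B W₁ A = k • F) : False := by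
  obtain ⟨k, hk⟩ := hcl
  have hk' : wedge n A (c • W₂) A - wedge n B (c • W₁) A = (c * k) • F := by
    rw [mul_smul, ← hk]
    simp only [wedge, mink_smul_left]
    module
  rw [hW₁, hW₂] at hk'
  simp only [wedge, mink_sub_left, mink_smul_left, hFA] at hk'
  rw [Fintype.linearIndependent_iff] at hli
  have h3 := hli ![h₂ * mink n A A - h₁ * mink n B A - c * k, 2 * f * mink n B A,
    -2 * f * mink n A A] (by
      simp only [Fin.sum_univ_three, Matrix.cons_val_zero, Matrix.cons_val_one, Matrix.cons_val]
      rw [← sub_eq_zero] at hk'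
      rw [← hk']
      module) 2
  have hAA : mink n A A = 0 := by simpa [hf] using h3
  have hF : F ≠ 0 := by
    rintro rfl
    have := hli ![1, 0, 0] (by simp [Fin.sum_univ_three]) 0
    simp at this
  obtain ⟨g, hg⟩ := exists_smul_of_null_of_null_of_mink_eq_zero n hF hFF hAA hFA
  have := hli ![-g, 1, 0] (by simp [Fin.sum_univ_three, hg]) 1
  simp at this

namespace IsothermicSurface

variable {n : ℕ} (S : IsothermicSurface n)

/-- A null section annihilated by `η` whose derivative is in the image of `η` vanishes. -/
lemma eq_zero_of_null {v w : Surf → MV n} (hv : ContDiff ℝ (⊤ : ℕ∞) v)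
    (h₁ : ∀ x, wedge n (S.F x) (S.W₁ x) (v x) = 0)
    (h₂ : ∀ x, wedge n (S.F x) (S.W₂ x) (v x) = 0)
    (hd₁ : ∀ x, fderiv ℝ v x du = -wedge n (S.F x) (S.W₁ x) (w x))
    (hd₂ : ∀ x, fderiv ℝ v x dv = -wedge n (S.F x) (S.W₂ x) (w x))
    (hnull : ∀ x, mink n (v x) (v x) = 0) : v = 0 := by
  have hprop : ∀ y ∈ S.etaSupport, ∃ f : ℝ, v y = f • S.F y := fun y hy =>
    exists_smul_of_null_of_null_of_mink_eq_zero n (S.F_ne y) (S.F_null y) (hnull y)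
      (S.mink_F_eq_zero hy (h₁ y) (h₂ y))
  have hzero : ∀ x ∈ S.etaSupport, v x = 0 := by
    intro x hx
    obtain ⟨f, hf⟩ := hprop x hx
    by_contra hvx
    have hf0 : f ≠ 0 := by rintro rfl; simp [hf] at hvx
    obtain ⟨z, hz⟩ : ∃ z, mink n (S.F x) z = 1 := by
      by_contra hcon
      apply S.F_ne x
      refine eq_zero_of_mink_eq_zero n _ fun y => ?_
      by_contra hy
      exact hcon ⟨(mink n (S.F x) y)⁻¹ • y, by rw [mink_smul_right, inv_mul_cancel₀ hy]⟩
    have hloc : (fun y => wedge n (v y) (S.F y) z) =ᶠ[nhds x] fun _ => 0 := by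
      filter_upwards [S.isOpen_etaSupport.mem_nhds hx] with y hy
      obtain ⟨g, hg⟩ := hprop y hy
      rw [hg]
      simp only [wedge, mink_smul_left]
      module
    have hder : ∀ e, ∃ k : ℝ, f • fderiv ℝ S.F x e = fderiv ℝ v x e + k • S.F x := by
      intro e
      have hh := fderiv_wedge hv S.smooth_F (contDiff_const (c := z)) x e
      rw [hloc.fderiv_eq] at hh
      simp only [fderiv_fun_const, Pi.zero_apply, _root_.zero_apply, wedge_zero,
        add_zero, hf] at hh
      simp only [wedge, mink_smul_left, hz, mul_one] at hh
      refine ⟨f * mink n (fderiv ℝ S.F x e) z - mink n (fderiv ℝ v x e) z, ?_⟩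
      rw [← sub_eq_zero]
      trans (0 : MV n)
      · rw [hh]; module
      · rfl
    obtain ⟨k₁, hk₁⟩ := hder du
    obtain ⟨k₂, hk₂⟩ := hder dv
    rw [hd₁] at hk₁
    rw [hd₂] at hk₂
    refine false_of_closed_of_proportional (c := mink n (S.F x) (w x)) (f := f)
      (W₁ := S.W₁ x) (W₂ := S.W₂ x) (h₁ := mink n (S.W₁ x) (w x) + k₁) (h₂ := mink n (S.W₂ x) (w x) + k₂)
      (S.immersed x) (S.F_null x) (S.mink_fderiv_F x du) hf0 ?_ ?_ ?_
    · simp only [pd]; rw [hk₁]; simp only [wedge]; module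
    · simp only [pd]; rw [hk₂]; simp only [wedge]; module
    · have hc := S.eta_closed x (pd du S.F x)
      rw [fderiv_wedge S.smooth_F S.smooth_W₂ contDiff_const,
        fderiv_wedge S.smooth_F S.smooth_W₁ contDiff_const] at hc
      simp only [fderiv_fun_const, Pi.zero_apply, _root_.zero_apply, wedge_zero,
        add_zero] at hc
      refine ⟨mink n (fderiv ℝ S.W₂ x du) (pd du S.F x)
        - mink n (fderiv ℝ S.W₁ x dv) (pd du S.F x), ?_⟩
      have hF : mink n (S.F x) (pd du S.F x) = 0 := S.mink_fderiv_F x du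
      simp only [wedge, hF, zero_smul, zero_sub] at hc
      simp only [wedge, pd] at hc ⊢
      rw [← sub_eq_zero] at hc ⊢
      rw [← hc]
      module
  have hconst : ∀ x, fderiv ℝ v x = 0 := by
    intro x
    by_cases hx : x ∈ S.etaSupport
    · have : v =ᶠ[nhds x] fun _ => 0 := by
        filter_upwards [S.isOpen_etaSupport.mem_nhds hx] with y hy using hzero y hy
      rw [this.fderiv_eq]; simp
    · have hx' : ∀ z, wedge n (S.F x) (S.W₁ x) z = 0 ∧ wedge n (S.F x) (S.W₂ x) z = 0 := by
        intro z
        by_contra hz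
        exact hx ⟨z, by tauto⟩
      have hu : fderiv ℝ v x du = 0 := by rw [hd₁, (hx' _).1, neg_zero]
      have hv' : fderiv ℝ v x dv = 0 := by rw [hd₂, (hx' _).2, neg_zero]
      exact eq_zero_of_apply_du_dv hu hv'
  obtain ⟨x₀, z, hz⟩ := S.eta_ne
  funext x
  rw [is_const_of_fderiv_eq_zero (hv.differentiable (by simp)) hconst x x₀]
  exact hzero x₀ ⟨z, hz⟩

end IsothermicSurface

/-- The coefficient sequence `P` satisfies the equations which, in the direction `e`, express that
`∑ t ^ k • P k` is parallel for `d + t F ∧ W` for all `t`. -/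
structure ConservedAlong {n : ℕ} (e : Surf) (F W : Surf → MV n) (P : ℕ → Surf → MV n) :
    Prop where
  zero : ∀ x, fderiv ℝ (P 0) x e = 0
  succ : ∀ k x, fderiv ℝ (P (k + 1)) x e = -wedge n (F x) (W x) (P k x)

/-- The coefficient sequence `P` satisfies the equations which express that `∑ t ^ k • P k` is
parallel for `d + tη` for all `t`. -/
structure IsConserved {n : ℕ} (S : IsothermicSurface n) (P : ℕ → Surf → MV n) : Prop where
  smooth : ∀ k, ContDiff ℝ (⊤ : ℕ∞) (P k)
  along_du : ConservedAlong du S.F S.W₁ P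
  along_dv : ConservedAlong dv S.F S.W₂ P

/-- Multiplication of a polynomial by the variable, on coefficient sequences. -/
def shiftSeq {E : Type*} [Zero E] (P : ℕ → E) : ℕ → E
  | 0 => 0
  | k + 1 => P k

@[simp] lemma shiftSeq_zero {E : Type*} [Zero E] (P : ℕ → E) : shiftSeq P 0 = 0 := rfl

@[simp] lemma shiftSeq_succ {E : Type*} [Zero E] (P : ℕ → E) (k : ℕ) :
    shiftSeq P (k + 1) = P k := rfl

lemma sum_shiftSeq {E : Type*} [AddCommGroup E] [Module ℝ E] (P : ℕ → E) (N : ℕ) (t : ℝ) :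
    ∑ k ∈ range (N + 1), t ^ k • shiftSeq P k = t • ∑ k ∈ range N, t ^ k • P k := by
  rw [Finset.sum_range_succ', Finset.smul_sum]
  simp [pow_succ', mul_smul]

lemma sum_range_eq_of_le {E : Type*} [AddCommGroup E] [Module ℝ E] {P : ℕ → E} {N M : ℕ}
    (hP : ∀ k, N ≤ k → P k = 0) (hNM : N ≤ M) (t : ℝ) :
    ∑ k ∈ range M, t ^ k • P k = ∑ k ∈ range N, t ^ k • P k := by
  symm
  apply Finset.sum_subset (by simpa using hNM)
  intro k _ hk
  rw [hP k (by simpa using hk), smul_zero]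

/-- A polynomial with vector coefficients vanishing off a finite set is zero. -/
lemma eq_zero_of_sum_pow_smul_eq_zero {n : ℕ} {v : ℕ → MV n} {N : ℕ} (A : Finset ℝ)
    (h : ∀ t ∉ A, ∑ k ∈ range N, t ^ k • v k = 0) {k : ℕ} (hk : k < N) : v k = 0 := by
  ext i
  let q : Polynomial ℝ := ∑ k ∈ range N, Polynomial.monomial k (v k i)
  have hq : q = 0 := by
    apply Polynomial.eq_zero_of_infinite_isRoot
    refine (Set.Finite.infinite_compl A.finite_toSet).mono fun t ht => ?_
    have := congrArg (fun z : MV n => z i) (h t (by simpa using ht))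
    simpa [q, Polynomial.IsRoot, Polynomial.eval_finsetSum, mul_comm] using this
  have := congrArg (fun r => Polynomial.coeff r k) hq
  simpa [q, Polynomial.finsetSum_coeff, Polynomial.coeff_monomial, hk] using this

lemma wedge_sum_pow_smul {n : ℕ} (u v : MV n) (P : ℕ → MV n) (N : ℕ) (t : ℝ) :
    wedge n u v (∑ k ∈ range N, t ^ k • P k) = ∑ k ∈ range N, t ^ k • wedge n u v (P k) := by
  induction N with
  | zero => simp [wedge_zero]
  | succ N ih => rw [Finset.sum_range_succ, Finset.sum_range_succ, wedge_add, ih, wedge_smul]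

lemma contDiff_sum_pow_smul {n : ℕ} {P : ℕ → Surf → MV n} (hP : ∀ k, ContDiff ℝ (⊤ : ℕ∞) (P k))
    (N : ℕ) (t : ℝ) : ContDiff ℝ (⊤ : ℕ∞) fun x => ∑ k ∈ range N, t ^ k • P k x :=
  ContDiff.sum fun k _ => (hP k).const_smul (t ^ k)

lemma fderiv_sum_pow_smul {n : ℕ} {P : ℕ → Surf → MV n} (hP : ∀ k, ContDiff ℝ (⊤ : ℕ∞) (P k))
    (N : ℕ) (t : ℝ) (x e : Surf) :
    fderiv ℝ (fun y => ∑ k ∈ range N, t ^ k • P k y) x e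
      = ∑ k ∈ range N, t ^ k • fderiv ℝ (P k) x e := by
  induction N with
  | zero => simp
  | succ N ih =>
    simp only [Finset.sum_range_succ]
    rw [fderiv_add_apply (contDiff_sum_pow_smul hP N t) ((hP N).const_smul (t ^ N)), ih,
      fderiv_const_smul_apply _ (hP N)]

lemma fderiv_add_smul_wedge_sum {n : ℕ} {P : ℕ → Surf → MV n}
    (hP : ∀ k, ContDiff ℝ (⊤ : ℕ∞) (P k)) {N : ℕ} (hN : P N = 0) (F W : Surf → MV n) (t : ℝ)
    (x e : Surf) :
    fderiv ℝ (fun y => ∑ k ∈ range N, t ^ k • P k y) x e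
        + t • wedge n (F x) (W x) (∑ k ∈ range N, t ^ k • P k x)
      = ∑ k ∈ range (N + 1), t ^ k • (fderiv ℝ (P k) x e
          + shiftSeq (fun j => wedge n (F x) (W x) (P j x)) k) := by
  simp only [smul_add, Finset.sum_add_distrib]
  rw [sum_shiftSeq, wedge_sum_pow_smul, fderiv_sum_pow_smul hP, Finset.sum_range_succ, hN]
  simp

lemma conservedAlong_iff {n : ℕ} {e : Surf} {F W : Surf → MV n} {P : ℕ → Surf → MV n} :
    ConservedAlong e F W P ↔ ∀ k x, fderiv ℝ (P k) x e
      + shiftSeq (fun j => wedge n (F x) (W x) (P j x)) k = 0 := by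
  constructor
  · rintro h (_ | k) x
    · simp [h.zero]
    · simp [h.succ]
  · intro h
    exact ⟨fun x => by simpa using h 0 x, fun k x => eq_neg_of_add_eq_zero_left (h (k + 1) x)⟩

lemma ConservedAlong.of_sum {n : ℕ} {e : Surf} {F W : Surf → MV n} {P : ℕ → Surf → MV n}
    (hP : ∀ k, ContDiff ℝ (⊤ : ℕ∞) (P k)) {N : ℕ} (hN : ∀ k, N ≤ k → P k = 0) (A : Finset ℝ)
    (h : ∀ t ∉ A, ∀ x, fderiv ℝ (fun y => ∑ k ∈ range N, t ^ k • P k y) x e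
      + t • wedge n (F x) (W x) (∑ k ∈ range N, t ^ k • P k x) = 0) :
    ConservedAlong e F W P := by
  rw [conservedAlong_iff]
  intro k x
  rcases lt_or_ge k (N + 1) with hk | hk
  · refine eq_zero_of_sum_pow_smul_eq_zero (v := fun k => fderiv ℝ (P k) x e
      + shiftSeq (fun j => wedge n (F x) (W x) (P j x)) k) (N := N + 1) A (fun t ht => ?_) hk
    rw [← fderiv_add_smul_wedge_sum hP (hN N le_rfl), h t ht x]
  · obtain ⟨k, rfl⟩ : ∃ j, k = j + 1 := ⟨k - 1, by omega⟩
    simp [hN (k + 1) (by omega), hN k (by omega), wedge_zero]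

lemma IsConserved.of_parallel {n : ℕ} {S : IsothermicSurface n} {P : ℕ → Surf → MV n}
    (hP : ∀ k, ContDiff ℝ (⊤ : ℕ∞) (P k)) {N : ℕ} (hN : ∀ k, N ≤ k → P k = 0) (A : Finset ℝ)
    (h : ∀ t ∉ A, ParallelSection n S t fun x => ∑ k ∈ range N, t ^ k • P k x) :
    IsConserved S P :=
  ⟨hP, .of_sum hP hN A fun t ht x => (h t ht x).1, .of_sum hP hN A fun t ht x => (h t ht x).2⟩

namespace IsConserved

variable {n : ℕ} {S : IsothermicSurface n} {P R : ℕ → Surf → MV n}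

lemma parallel (h : IsConserved S P) {N : ℕ} (hN : P N = 0) (t : ℝ) :
    ParallelSection n S t fun x => ∑ k ∈ range N, t ^ k • P k x := by
  intro x
  constructor
  · rw [fderiv_add_smul_wedge_sum h.smooth hN]
    exact Finset.sum_eq_zero fun k _ => by rw [conservedAlong_iff.1 h.along_du, smul_zero]
  · rw [fderiv_add_smul_wedge_sum h.smooth hN]
    exact Finset.sum_eq_zero fun k _ => by rw [conservedAlong_iff.1 h.along_dv, smul_zero]

lemma _root_.PolyConservedQuantity.isConserved {d : ℕ} (p : PolyConservedQuantity n S d) :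
    IsConserved S p.coeff :=
  .of_parallel p.smooth (N := d + 1) (fun k hk => p.coeff_eq_zero k hk) ∅
    fun t _ => p.conserved t

/-- The polynomial conserved quantity of degree `d` with given coefficients. -/
def toPolyConservedQuantity (h : IsConserved S P) {d : ℕ} (hd : ∀ k, d < k → P k = 0)
    (htop : P d ≠ 0) : PolyConservedQuantity n S d where
  coeff := P
  smooth := h.smooth
  coeff_eq_zero := hd
  top_ne := htop
  conserved := h.parallel (hd _ (Nat.lt_succ_self d))

lemma shift (h : IsConserved S P) : IsConserved S (shiftSeq P) := by
  refine ⟨?_, ⟨?_, ?_⟩, ⟨?_, ?_⟩⟩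
  · rintro (_ | k)
    · exact contDiff_const
    · exact h.smooth k
  · simp
  · rintro (_ | k) x
    · simp [h.along_du.zero, wedge_zero]
    · simp [h.along_du.succ]
  · simp
  · rintro (_ | k) x
    · simp [h.along_dv.zero, wedge_zero]
    · simp [h.along_dv.succ]

/-- The quotient by the variable of a difference with the same constant term. -/
lemma unshift_sub (hP : IsConserved S P) (hR : IsConserved S R) (h0 : R 0 = P 0) :
    IsConserved S fun k x => R (k + 1) x - P (k + 1) x := by
  have hs : ∀ k x e, fderiv ℝ (fun x => R k x - P k x) x e
      = fderiv ℝ (R k) x e - fderiv ℝ (P k) x e := fun k x e =>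
    fderiv_sub_apply (hR.smooth k) (hP.smooth k) x e
  refine ⟨fun k => (hR.smooth _).sub (hP.smooth _), ⟨fun x => ?_, fun k x => ?_⟩,
    ⟨fun x => ?_, fun k x => ?_⟩⟩
  · rw [hs, hR.along_du.succ, hP.along_du.succ, h0, sub_self]
  · rw [hs, hR.along_du.succ, hP.along_du.succ, wedge_sub]; abel
  · rw [hs, hR.along_dv.succ, hP.along_dv.succ, h0, sub_self]
  · rw [hs, hR.along_dv.succ, hP.along_dv.succ, wedge_sub]; abel

lemma sub_smul (hR : IsConserved S R) (hP : IsConserved S P) (a : ℝ) :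
    IsConserved S fun k x => R k x - a • P k x := by
  have hs : ∀ k x e, fderiv ℝ (fun x => R k x - a • P k x) x e
      = fderiv ℝ (R k) x e - a • fderiv ℝ (P k) x e := fun k x e => by
    rw [fderiv_sub_apply (hR.smooth k) ((hP.smooth k).const_smul a),
      fderiv_const_smul_apply a (hP.smooth k)]
  refine ⟨fun k => (hR.smooth _).sub ((hP.smooth _).const_smul a),
    ⟨fun x => ?_, fun k x => ?_⟩, ⟨fun x => ?_, fun k x => ?_⟩⟩
  · rw [hs, hR.along_du.zero, hP.along_du.zero]; simp
  · rw [hs, hR.along_du.succ, hP.along_du.succ, wedge_sub, wedge_smul]; module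
  · rw [hs, hR.along_dv.zero, hP.along_dv.zero]; simp
  · rw [hs, hR.along_dv.succ, hP.along_dv.succ, wedge_sub, wedge_smul]; module

lemma wedge_top (h : IsConserved S P) {N : ℕ} (hN : P (N + 1) = 0) (x : Surf) :
    wedge n (S.F x) (S.W₁ x) (P N x) = 0 ∧ wedge n (S.F x) (S.W₂ x) (P N x) = 0 := by
  have h₁ := h.along_du.succ N x
  have h₂ := h.along_dv.succ N x
  rw [hN] at h₁ h₂
  simp only [fderiv_zero, Pi.zero_apply, _root_.zero_apply, zero_eq_neg] at h₁ h₂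
  exact ⟨h₁, h₂⟩

lemma fderiv_eq (h : IsConserved S P) (N : ℕ) (x : Surf) :
    fderiv ℝ (P N) x du = -wedge n (S.F x) (S.W₁ x) (shiftSeq P N x)
      ∧ fderiv ℝ (P N) x dv = -wedge n (S.F x) (S.W₂ x) (shiftSeq P N x) := by
  rcases N with _ | N
  · simp [h.along_du.zero, h.along_dv.zero, wedge_zero]
  · exact ⟨h.along_du.succ N x, h.along_dv.succ N x⟩

/-- The top coefficient vanishes if it is null. -/
lemma top_eq_zero_of_null (h : IsConserved S P) {N : ℕ} (hN : P (N + 1) = 0)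
    (hnull : ∀ x, mink n (P N x) (P N x) = 0) : P N = 0 :=
  S.eq_zero_of_null (h.smooth N) (fun x => (h.wedge_top hN x).1) (fun x => (h.wedge_top hN x).2)
    (fun x => (h.fderiv_eq N x).1) (fun x => (h.fderiv_eq N x).2) hnull

lemma mink_top_const (hP : IsConserved S P) (hR : IsConserved S R) {N : ℕ}
    (hPN : P (N + 1) = 0) (hRN : R (N + 1) = 0) (x y : Surf) :
    mink n (P N x) (R N x) = mink n (P N y) (R N y) := by
  refine is_const_of_fderiv_eq_zero (𝕜 := ℝ) (f := fun x => mink n (P N x) (R N x))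
    (((hP.smooth N).mink (hR.smooth N)).differentiable (by simp)) (fun x => ?_) x y
  apply eq_zero_of_apply_du_dv
  · rw [fderiv_mink (hP.smooth N) (hR.smooth N), (hP.fderiv_eq N x).1, (hR.fderiv_eq N x).1,
      mink_neg_left, mink_neg_right, mink_wedge_left, ← neg_eq_iff_eq_neg.2 (mink_wedge_left n
      (S.F x) (S.W₁ x) (P N x) (shiftSeq R N x)), (hP.wedge_top hPN x).1, (hR.wedge_top hRN x).1]
    simp [mink_zero_left, mink_zero_right]
  · rw [fderiv_mink (hP.smooth N) (hR.smooth N), (hP.fderiv_eq N x).2, (hR.fderiv_eq N x).2,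
      mink_neg_left, mink_neg_right, mink_wedge_left, ← neg_eq_iff_eq_neg.2 (mink_wedge_left n
      (S.F x) (S.W₂ x) (P N x) (shiftSeq R N x)), (hP.wedge_top hPN x).2, (hR.wedge_top hRN x).2]
    simp [mink_zero_left, mink_zero_right]

/-- Where `η ≠ 0`, the top coefficient is a section of `(Λ ⊕ dΛ)^⊥`. -/
lemma top_perp (h : IsConserved S P) {N : ℕ} (hN : P (N + 1) = 0) {x : Surf}
    (hx : x ∈ S.etaSupport) :
    mink n (S.F x) (P N x) = 0 ∧ mink n (pd du S.F x) (P N x) = 0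
      ∧ mink n (pd dv S.F x) (P N x) = 0 := by
  have hF : ∀ y ∈ S.etaSupport, mink n (S.F y) (P N y) = 0 := fun y hy =>
    S.mink_F_eq_zero hy (h.wedge_top hN y).1 (h.wedge_top hN y).2
  have hloc : (fun y => mink n (S.F y) (P N y)) =ᶠ[nhds x] fun _ => 0 := by
    filter_upwards [S.isOpen_etaSupport.mem_nhds hx] with y hy using hF y hy
  have hd : ∀ e, mink n (fderiv ℝ S.F x e) (P N x) + mink n (S.F x) (fderiv ℝ (P N) x e) = 0 := by
    intro e
    rw [← fderiv_mink S.smooth_F (h.smooth N), hloc.fderiv_eq]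
    simp
  refine ⟨hF x hx, ?_, ?_⟩
  · have := hd du
    rwa [(h.fderiv_eq N x).1, mink_neg_right, mink_comm n (S.F x),
      mink_wedge_eq_zero n (S.F_null x) (S.W₁_perp x), neg_zero, add_zero] at this
  · have := hd dv
    rwa [(h.fderiv_eq N x).2, mink_neg_right, mink_comm n (S.F x),
      mink_wedge_eq_zero n (S.F_null x) (S.W₂_perp x), neg_zero, add_zero] at this

/-- A surface which is not special isothermic of type `d - 1` has no nonzero conserved quantity of
degree less than `d`. -/
lemma eq_zero_of_not_special {d : ℕ} (hd : 1 ≤ d) (hnot : ¬ SpecialOfType n S (d - 1))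
    (h : IsConserved S P) (hdeg : ∀ k, d ≤ k → P k = 0) (k : ℕ) : P k = 0 := by
  have aux : ∀ j k, k + j = d - 1 → ∀ Q : ℕ → Surf → MV n, IsConserved S Q →
      (∀ i, k < i → Q i = 0) → Q k = 0 := by
    intro j
    induction j with
    | zero =>
      intro k hk Q hQ hi
      by_contra hne
      obtain rfl : k = d - 1 := by omega
      exact hnot ⟨hQ.toPolyConservedQuantity hi hne⟩
    | succ j ih =>
      intro k hk Q hQ hi
      refine ih (k + 1) (by omega) (shiftSeq Q) hQ.shift fun i hki => ?_
      obtain ⟨i, rfl⟩ : ∃ l, i = l + 1 := ⟨i - 1, by omega⟩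
      exact hi i (by omega)
  have main : ∀ j, ∀ k, d ≤ k + j → P k = 0 := by
    intro j
    induction j with
    | zero => intro k hk; exact hdeg k hk
    | succ j ih =>
      intro k hk
      rcases Nat.lt_or_ge k d with hkd | hkd
      · exact aux (d - 1 - k) k (by omega) P h fun i hi => ih i (by omega)
      · exact hdeg k hkd
  exact main d k (by omega)

end IsConserved

/-- In `S³` the conserved quantities of minimal degree are unique up to scale. -/
lemma IsConserved.exists_eq_smul {S : IsothermicSurface 3} {P R : ℕ → Surf → MV 3} {d : ℕ}
    (hd : 1 ≤ d) (hnot : ¬ SpecialOfType 3 S (d - 1)) (hP : IsConserved S P)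
    (hR : IsConserved S R) (hPd : ∀ k, d < k → P k = 0) (hRd : ∀ k, d < k → R k = 0)
    (htop : P d ≠ 0) : ∃ a : ℝ, ∀ k x, R k x = a • P k x := by
  have hP1 := hPd (d + 1) (Nat.lt_succ_self d)
  have hR1 := hRd (d + 1) (Nat.lt_succ_self d)
  obtain ⟨x₀, hx₀⟩ := S.eta_ne
  obtain ⟨p₀, p₁, p₂⟩ := hP.top_perp hP1 (x := x₀) hx₀
  obtain ⟨r₀, r₁, r₂⟩ := hR.top_perp hR1 (x := x₀) hx₀
  have hgram := gram_eq_zero (S.immersed x₀) (S.F_null x₀) (S.mink_fderiv_F x₀ du)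
    (S.mink_fderiv_F x₀ dv) p₀ p₁ p₂ r₀ r₁ r₂
  have hA : mink 3 (P d x₀) (P d x₀) ≠ 0 := fun h0 =>
    htop (hP.top_eq_zero_of_null hP1 fun x => by rw [hP.mink_top_const hP hP1 hP1 x x₀, h0])
  set a := mink 3 (P d x₀) (R d x₀) / mink 3 (P d x₀) (P d x₀) with ha
  have hQ := hR.sub_smul hP a
  have hQtop : (fun x => R d x - a • P d x) = 0 := by
    refine hQ.top_eq_zero_of_null (N := d) (by funext x; simp [hP1, hR1]) fun x => ?_
    simp only [mink_sub_left, mink_sub_right, mink_smul_left, mink_smul_right,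
      mink_comm 3 (R d x) (P d x)]
    rw [hP.mink_top_const hP hP1 hP1 x x₀, hP.mink_top_const hR hP1 hR1 x x₀,
      hR.mink_top_const hR hR1 hR1 x x₀, ha]
    field_simp
    linear_combination hgram
  refine ⟨a, fun k x => ?_⟩
  have := hQ.eq_zero_of_not_special hd hnot (fun k hk => ?_) k
  · exact sub_eq_zero.1 (congrFun this x)
  · rcases hk.eq_or_lt with rfl | hk
    · exact hQtop
    · funext x; simp [hPd k hk, hRd k hk]

lemma mink_left_gaugeG {n : ℕ} {F G : MV n} (hF : mink n F F = 0) (hFG : mink n F G ≠ 0)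
    (c : ℝ) (z : MV n) :
    mink n F (gaugeG n F G c z) = c * mink n F z := by
  simp only [gaugeG, mink_add_right, mink_sub_right, mink_smul_right, hF]
  rcases eq_or_ne c 0 with rfl | hc
  · field_simp
    ring
  · field_simp
    ring

lemma mink_right_gaugeG {n : ℕ} {F G : MV n} (hG : mink n G G = 0) (hFG : mink n F G ≠ 0)
    (c : ℝ) (z : MV n) :
    mink n G (gaugeG n F G c z) = mink n G z / c := by
  simp only [gaugeG, mink_add_right, mink_sub_right, mink_smul_right, hG, mink_comm n G F]
  field_simp
  ring

lemma gaugeG_gaugeG_inv {n : ℕ} {F G : MV n} (hF : mink n F F = 0) (hG : mink n G G = 0) (hFG : mink n F G ≠ 0)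
    {c : ℝ} (hc : c ≠ 0) (z : MV n) :
    gaugeG n F G c (gaugeG n F G c⁻¹ z) = z := by
  rw [gaugeG, mink_left_gaugeG hF hFG, mink_right_gaugeG hG hFG, gaugeG]
  match_scalars <;> field_simp <;> ring

lemma eq_zero_of_gaugeG_eq_zero {n : ℕ} {F G : MV n} (hF : mink n F F = 0) (hG : mink n G G = 0) (hFG : mink n F G ≠ 0)
    {c : ℝ} (hc : c ≠ 0) {z : MV n} (h : gaugeG n F G c z = 0) :
    z = 0 := by
  have h1 := gaugeG_gaugeG_inv hF hG hFG (inv_ne_zero hc) z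
  rw [inv_inv, h] at h1
  rw [← h1]
  simp [gaugeG, mink_zero_right]

lemma ContDiff.gaugeG {n : ℕ} {F G z : Surf → MV n} (hF : ContDiff ℝ (⊤ : ℕ∞) F)
    (hG : ContDiff ℝ (⊤ : ℕ∞) G) (hz : ContDiff ℝ (⊤ : ℕ∞) z)
    (hFG : ∀ x, _root_.mink n (F x) (G x) ≠ 0) (c : ℝ) :
    ContDiff ℝ (⊤ : ℕ∞) fun x => gaugeG n (F x) (G x) c (z x) := by
  have h₁ : ContDiff ℝ (⊤ : ℕ∞) fun x => _root_.mink n (G x) (z x) / _root_.mink n (F x) (G x) :=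
    (hG.mink hz).div (hF.mink hG) hFG
  have h₂ : ContDiff ℝ (⊤ : ℕ∞) fun x => _root_.mink n (F x) (z x) / _root_.mink n (F x) (G x) :=
    (hF.mink hz).div (hF.mink hG) hFG
  exact (((h₁.div_const c).smul hF).add ((contDiff_const.mul h₂).smul hG)).add
    ((hz.sub (h₁.smul hF)).sub (h₂.smul hG))

/-- The coefficient of `t` in `(1 - t/m) Γ_{⟨F⟩}^{⟨G⟩}((1 - t/m)⁻¹)`. -/
def gaugeCoeffOne {n : ℕ} (F G : MV n) (m : ℝ) : MV n →ₗ[ℝ] MV n :=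
  (-m⁻¹) • (LinearMap.id + (mink n F G)⁻¹ • (minkForm n G).smulRight F
    - (mink n F G)⁻¹ • (minkForm n F).smulRight G)

/-- The coefficient of `t ^ 2` in `(1 - t/m) Γ_{⟨F⟩}^{⟨G⟩}((1 - t/m)⁻¹)`. -/
def gaugeCoeffTwo {n : ℕ} (F G : MV n) (m : ℝ) : MV n →ₗ[ℝ] MV n :=
  (m⁻¹ ^ 2 * (mink n F G)⁻¹) • (minkForm n G).smulRight F

lemma gaugeCoeffOne_apply {n : ℕ} (F G : MV n) (m : ℝ) (z : MV n) :
    gaugeCoeffOne F G m z = (-m⁻¹) • (z + ((mink n F G)⁻¹ * mink n G z) • F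
      - ((mink n F G)⁻¹ * mink n F z) • G) := by
  simp [gaugeCoeffOne, mul_smul]

lemma gaugeCoeffTwo_apply {n : ℕ} (F G : MV n) (m : ℝ) (z : MV n) :
    gaugeCoeffTwo F G m z = (m⁻¹ ^ 2 * (mink n F G)⁻¹ * mink n G z) • F := by
  simp [gaugeCoeffTwo, mul_smul]

lemma smul_gaugeG_inv_eq {n : ℕ} (F G : MV n) {m t : ℝ} (hm : m ≠ 0) (ht : t ≠ m) (z : MV n) :
    (1 - t / m) • gaugeG n F G (1 - t / m)⁻¹ z
      = z + t • gaugeCoeffOne F G m z + t ^ 2 • gaugeCoeffTwo F G m z := by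
  have hc : 1 - t / m ≠ 0 := by
    rw [sub_ne_zero, ne_comm, Ne, div_eq_one_iff_eq hm]
    exact ht
  have hmt : m - t ≠ 0 := sub_ne_zero.2 ht.symm
  rw [gaugeCoeffOne_apply, gaugeCoeffTwo_apply, gaugeG]
  match_scalars <;> field_simp <;> ring

/-- The coefficient sequence of `(1 - t/m) Γ_{⟨F⟩}^{⟨G⟩}((1 - t/m)⁻¹)` applied to the polynomial
with coefficient sequence `z`. -/
def gaugeSeq {n : ℕ} (F G : Surf → MV n) (m : ℝ) (z : ℕ → Surf → MV n) (k : ℕ) :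
    Surf → MV n :=
  z k + shiftSeq (fun j x => gaugeCoeffOne (F x) (G x) m (z j x)) k
    + shiftSeq (shiftSeq fun j x => gaugeCoeffTwo (F x) (G x) m (z j x)) k

lemma sum_gaugeSeq {n : ℕ} (F G : Surf → MV n) (m : ℝ) {z : ℕ → Surf → MV n} {d : ℕ}
    (hz : ∀ k, d < k → z k = 0) (t : ℝ) (x : Surf) :
    ∑ k ∈ range (d + 3), t ^ k • gaugeSeq F G m z k x
      = (∑ k ∈ range (d + 1), t ^ k • z k x)
        + t • gaugeCoeffOne (F x) (G x) m (∑ k ∈ range (d + 1), t ^ k • z k x)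
        + t ^ 2 • gaugeCoeffTwo (F x) (G x) m (∑ k ∈ range (d + 1), t ^ k • z k x) := by
  have hA : ∀ k, d + 1 ≤ k → (fun x => gaugeCoeffOne (F x) (G x) m (z k x)) = 0 := by
    intro k hk
    funext x
    simp [hz k hk]
  have h : ∑ k ∈ range (d + 3), t ^ k • gaugeSeq F G m z k
      = ∑ k ∈ range (d + 1), t ^ k • z k
        + t • ∑ k ∈ range (d + 1), t ^ k • (fun x => gaugeCoeffOne (F x) (G x) m (z k x))
        + t ^ 2 • ∑ k ∈ range (d + 1), t ^ k • fun x => gaugeCoeffTwo (F x) (G x) m (z k x) := by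
    simp only [gaugeSeq, smul_add, Finset.sum_add_distrib]
    rw [sum_shiftSeq, sum_shiftSeq, sum_shiftSeq, sum_range_eq_of_le (N := d + 1) (M := d + 3)
      (fun k hk => hz k hk) (by omega), sum_range_eq_of_le (N := d + 1) (M := d + 2) hA (by omega),
      pow_two, mul_smul]
  have hx := congrFun h x
  simp only [Finset.sum_apply, Pi.add_apply, Pi.smul_apply] at hx
  simpa only [map_sum, map_smul] using hx

lemma DarbouxTransform.mink_ne_zero {n : ℕ} {S : IsothermicSurface n} {m : ℝ}
    (D : DarbouxTransform n S m) (x : Surf) : mink n (S.F x) (D.G x) ≠ 0 :=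
  mink_ne_zero_of_null n (S.F_ne x) (S.F_null x) (D.G_null x) (D.disjoint x)

lemma contDiff_shiftSeq {n : ℕ} {P : ℕ → Surf → MV n} (h : ∀ k, ContDiff ℝ (⊤ : ℕ∞) (P k)) :
    ∀ k, ContDiff ℝ (⊤ : ℕ∞) (shiftSeq P k)
  | 0 => contDiff_const
  | k + 1 => h k

lemma contDiff_gaugeSeq {n : ℕ} {F G : Surf → MV n} {m : ℝ} {z : ℕ → Surf → MV n}
    (hF : ContDiff ℝ (⊤ : ℕ∞) F) (hG : ContDiff ℝ (⊤ : ℕ∞) G)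
    (hz : ∀ k, ContDiff ℝ (⊤ : ℕ∞) (z k)) (hFG : ∀ x, mink n (F x) (G x) ≠ 0) (k : ℕ) :
    ContDiff ℝ (⊤ : ℕ∞) (gaugeSeq F G m z k) := by
  have hK := (hF.mink hG).inv hFG
  refine ((hz k).add (contDiff_shiftSeq (fun j => ?_) k)).add
    (contDiff_shiftSeq (contDiff_shiftSeq fun j => ?_) k)
  · simp only [gaugeCoeffOne_apply]
    exact (((hz j).add ((hK.mul (hG.mink (hz j))).smul hF)).sub
      ((hK.mul (hF.mink (hz j))).smul hG)).const_smul _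
  · simp only [gaugeCoeffTwo_apply]
    exact ((contDiff_const.mul hK).mul (hG.mink (hz j))).smul hF

/-- Undoing the gauge transformation carries a conserved quantity of a Darboux transform to a
conserved quantity of the original surface. -/
lemma GaugeRel.isConserved_gaugeSeq {n : ℕ} {S T : IsothermicSurface n} {m : ℝ} (hm : m ≠ 0)
    (hg : GaugeRel n S T m) (hFT : ∀ x, mink n (S.F x) (T.F x) ≠ 0)
    {z : ℕ → Surf → MV n} (hz : IsConserved T z) {d : ℕ} (hd : ∀ k, d < k → z k = 0) :
    IsConserved S (gaugeSeq S.F T.F m z) := by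
  refine .of_parallel (contDiff_gaugeSeq S.smooth_F T.smooth_F hz.smooth hFT) (N := d + 3)
    (fun k hk => ?_) {m} fun t ht => ?_
  · obtain ⟨k, rfl⟩ : ∃ j, k = j + 2 := ⟨k - 2, by omega⟩
    funext x
    simp [gaugeSeq, hd (k + 2) (by omega), hd (k + 1) (by omega), hd k (by omega)]
  · have htm : t ≠ m := by simpa using ht
    have hc : 1 - t / m ≠ 0 := by
      rw [sub_ne_zero, ne_comm, Ne, div_eq_one_iff_eq hm]
      exact htm
    set Z : Surf → MV n := fun x => ∑ k ∈ range (d + 1), t ^ k • z k x with hZ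
    have hZs : ContDiff ℝ (⊤ : ℕ∞) Z := contDiff_sum_pow_smul hz.smooth _ t
    have hs := ContDiff.gaugeG S.smooth_F T.smooth_F hZs hFT (1 - t / m)⁻¹
    have hpar := hz.parallel (hd _ (Nat.lt_succ_self d)) t
    have heq : (fun x => ∑ k ∈ range (d + 3), t ^ k • gaugeSeq S.F T.F m z k x)
        = fun x => (1 - t / m) • gaugeG n (S.F x) (T.F x) (1 - t / m)⁻¹ (Z x) := by
      funext x
      rw [sum_gaugeSeq S.F T.F m hd, smul_gaugeG_inv_eq _ _ hm htm]
    rw [heq]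
    have hinv : ∀ x, gaugeG n (S.F x) (T.F x) (1 - t / m)
        (gaugeG n (S.F x) (T.F x) (1 - t / m)⁻¹ (Z x)) = Z x := fun x =>
      gaugeG_gaugeG_inv (S.F_null x) (T.F_null x) (hFT x) hc (Z x)
    intro x
    have hrel := hg t htm _ hs x
    simp only [hinv] at hrel
    have h₁ := eq_zero_of_gaugeG_eq_zero (S.F_null x) (T.F_null x) (hFT x) hc
      (hrel.1.symm.trans (hpar x).1)
    have h₂ := eq_zero_of_gaugeG_eq_zero (S.F_null x) (T.F_null x) (hFT x) hc
      (hrel.2.symm.trans (hpar x).2)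
    rw [fderiv_const_smul_apply _ hs, fderiv_const_smul_apply _ hs]
    constructor
    · rw [wedge_smul, smul_comm t, ← smul_add, h₁, smul_zero]
    · rw [wedge_smul, smul_comm t, ← smul_add, h₂, smul_zero]

/-- If a Darboux transform of parameter `m` shares the type and the constant term of the conserved
quantity `p`, then `p m` is orthogonal to it. -/
lemma mink_pcEval_darboux_eq_zero {d : ℕ} (hd : 1 ≤ d) {S : IsothermicSurface 3}
    (p : PolyConservedQuantity 3 S d) (hnot : ¬ SpecialOfType 3 S (d - 1))
    {m : ℝ} (hm : m ≠ 0) (D : DarbouxTransform 3 S m)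
    {T : IsothermicSurface 3} (hT : T.F = D.G) (hg : GaugeRel 3 S T m)
    (q : PolyConservedQuantity 3 T d) (h0 : ∀ x, q.coeff 0 x = p.coeff 0 x) (x : Surf) :
    mink 3 (∑ k ∈ range (d + 1), m ^ k • p.coeff k x) (D.G x) = 0 := by
  have hFT : ∀ x, mink 3 (S.F x) (T.F x) ≠ 0 := by rw [hT]; exact D.mink_ne_zero
  have hP := p.isConserved
  set Q := gaugeSeq S.F T.F m q.coeff with hQdef
  have hQ : IsConserved S Q := hg.isConserved_gaugeSeq hm hFT q.isConserved q.coeff_eq_zero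
  have hQdeg : ∀ k, d + 2 < k → Q k = 0 := by
    intro k hk
    obtain ⟨k, rfl⟩ : ∃ j, k = j + 2 := ⟨k - 2, by omega⟩
    funext x
    simp [hQdef, gaugeSeq, q.coeff_eq_zero (k + 2) (by omega), q.coeff_eq_zero (k + 1) (by omega),
      q.coeff_eq_zero k (by omega)]
  have hQtop : Q (d + 2) = 0 := by
    refine hQ.top_eq_zero_of_null (hQdeg _ (by omega)) fun x => ?_
    have : Q (d + 2) x = gaugeCoeffTwo (S.F x) (T.F x) m (q.coeff d x) := by
      simp [hQdef, gaugeSeq, q.coeff_eq_zero (d + 2) (by omega), q.coeff_eq_zero (d + 1) (by omega)]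
    rw [this, gaugeCoeffTwo_apply, mink_smul_left, mink_smul_right, S.F_null]
    simp
  have hQ0 : Q 0 = p.coeff 0 := by
    funext x
    simp [hQdef, gaugeSeq, h0]
  have hQdeg' : ∀ k, d + 2 ≤ k → Q k = 0 := by
    intro k hk
    rcases hk.eq_or_lt with rfl | hk
    exacts [hQtop, hQdeg k hk]
  obtain ⟨a, ha⟩ := IsConserved.exists_eq_smul hd hnot hP (hP.unshift_sub hQ hQ0)
    p.coeff_eq_zero (fun k hk => by
      funext x; simp [hQdeg' (k + 1) (by omega), p.coeff_eq_zero (k + 1) (by omega)]) p.top_ne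
  have hQP : ∀ k, Q k = p.coeff k + a • shiftSeq p.coeff k := by
    rintro (_ | k)
    · simp [hQ0]
    · funext x
      simpa [sub_eq_iff_eq_add'] using ha k x
  have hpoly : ∀ t : ℝ, (1 + a * t) * mink 3 (∑ k ∈ range (d + 1), t ^ k • p.coeff k x) (D.G x)
      = (1 - t / m) ^ 2 * mink 3 (∑ k ∈ range (d + 1), t ^ k • q.coeff k x) (D.G x) := by
    intro t
    have h₁ := sum_gaugeSeq S.F T.F m q.coeff_eq_zero t x
    have h₂ : ∑ k ∈ range (d + 3), t ^ k • Q k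
        = (1 + a * t) • ∑ k ∈ range (d + 1), t ^ k • p.coeff k := by
      simp only [hQP, smul_add, Finset.sum_add_distrib, smul_comm _ a]
      rw [← Finset.smul_sum, sum_shiftSeq, sum_range_eq_of_le (N := d + 1) (M := d + 3)
        (fun k hk => p.coeff_eq_zero k hk) (by omega), sum_range_eq_of_le (N := d + 1)
        (M := d + 2) (fun k hk => p.coeff_eq_zero k hk) (by omega)]
      module
    have h₃ := congrFun h₂ x
    simp only [Finset.sum_apply, Pi.smul_apply] at h₃
    rw [← hQdef, h₃] at h₁
    have h₄ := congrArg (fun z => mink 3 z (D.G x)) h₁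
    simp only [gaugeCoeffOne_apply, gaugeCoeffTwo_apply, mink_add_left, mink_sub_left,
      mink_smul_left, hT, D.G_null, mink_comm 3 (D.G x) (∑ k ∈ _, _)] at h₄
    rw [h₄]
    have := D.mink_ne_zero x
    field_simp
    ring
  by_cases ham : 1 + a * m = 0
  · have hcont : ∀ v : ℕ → Surf → MV 3, Continuous fun t : ℝ =>
        mink 3 (∑ k ∈ range (d + 1), t ^ k • v k x) (D.G x) := by
      intro v
      simp only [mink_sum_left, mink_smul_left]
      fun_prop
    have hext := Continuous.ext_on (dense_compl_singleton m) (hcont p.coeff)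
      (((continuous_const (y := (1 : ℝ))).sub (continuous_id.div_const m)).mul (hcont q.coeff))
      (fun t ht => by
        have htm : t ≠ m := ht
        have hc : 1 - t / m ≠ 0 := by
          rw [sub_ne_zero, ne_comm, Ne, div_eq_one_iff_eq hm]
          exact htm
        apply mul_left_cancel₀ hc
        have hat : 1 + a * t = 1 - t / m := by
          have : a = -1 / m := by field_simp; linarith
          rw [this]; ring
        rw [← hat, hpoly t, hat]
        simp only [Pi.mul_apply, Pi.sub_apply, id]
        ring)
    have := congrFun hext m
    simpa [hm] using this
  · have := hpoly m
    rw [div_self hm] at this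
    simpa [ham] using this

/-- The coefficient sequence of the power series `α / (1 - t/m)`. -/
def quotSeq (m : ℝ) (α : ℕ → ℝ) : ℕ → ℝ
  | 0 => α 0
  | k + 1 => α (k + 1) + quotSeq m α k / m

lemma pow_mul_quotSeq {m : ℝ} (hm : m ≠ 0) (α : ℕ → ℝ) (k : ℕ) :
    m ^ k * quotSeq m α k = ∑ j ∈ range (k + 1), m ^ j * α j := by
  induction k with
  | zero => simp [quotSeq]
  | succ k ih =>
    rw [Finset.sum_range_succ, ← ih, quotSeq]
    field_simp
    ring

lemma quotSeq_eq_zero {m : ℝ} (hm : m ≠ 0) {α : ℕ → ℝ} {d : ℕ} (hα : ∀ k, d < k → α k = 0)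
    (hroot : ∑ j ∈ range (d + 1), m ^ j * α j = 0) {k : ℕ} (hk : d ≤ k) :
    quotSeq m α k = 0 := by
  induction k, hk using Nat.le_induction with
  | base =>
    have := pow_mul_quotSeq hm α d
    rw [hroot] at this
    simpa [hm] using this
  | succ k hk ih => simp [quotSeq, ih, hα (k + 1) (by omega)]

lemma sum_pow_mul_quotSeq (m t : ℝ) (α : ℕ → ℝ) (N : ℕ) :
    ∑ k ∈ range (N + 1), t ^ k * α k
      = (1 - t / m) * (∑ k ∈ range (N + 1), t ^ k * quotSeq m α k)
        + t ^ (N + 1) * quotSeq m α N / m := by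
  induction N with
  | zero => simp [quotSeq]; ring
  | succ N ih =>
    rw [Finset.sum_range_succ, ih, Finset.sum_range_succ (fun k => t ^ k * quotSeq m α k) (N + 1),
      show quotSeq m α (N + 1) = α (N + 1) + quotSeq m α N / m from rfl]
    ring

/-- The coefficients of `(P t, G) / (1 - t/m)`. -/
def pairQuot {n : ℕ} (P : ℕ → Surf → MV n) (G : Surf → MV n) (m : ℝ) (k : ℕ) (x : Surf) : ℝ :=
  quotSeq m (fun j => mink n (P j x) (G x)) k

lemma contDiff_pairQuot {n : ℕ} {P : ℕ → Surf → MV n} {G : Surf → MV n}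
    (hP : ∀ k, ContDiff ℝ (⊤ : ℕ∞) (P k)) (hG : ContDiff ℝ (⊤ : ℕ∞) G) (m : ℝ) (k : ℕ) :
    ContDiff ℝ (⊤ : ℕ∞) (pairQuot P G m k) := by
  induction k with
  | zero => exact (hP 0).mink hG
  | succ k ih => exact ((hP (k + 1)).mink hG).add (ih.div_const m)

lemma fderiv_pairQuot {n : ℕ} {e : Surf} {F W : Surf → MV n} {P : ℕ → Surf → MV n}
    {G : Surf → MV n} {m : ℝ} (hm : m ≠ 0) (hP : ∀ k, ContDiff ℝ (⊤ : ℕ∞) (P k))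
    (hG : ContDiff ℝ (⊤ : ℕ∞) G) (h : ConservedAlong e F W P)
    (hGpar : ∀ x, fderiv ℝ G x e = -(m • wedge n (F x) (W x) (G x))) (k : ℕ) (x : Surf) :
    fderiv ℝ (pairQuot P G m k) x e = m * mink n (wedge n (F x) (W x) (P k x)) (G x) := by
  induction k with
  | zero =>
    change fderiv ℝ (fun x => mink n (P 0 x) (G x)) x e = _
    rw [fderiv_mink (hP 0) hG, h.zero, hGpar, mink_neg_right, mink_smul_right, mink_zero_left,
      mink_wedge_left]
    ring
  | succ k ih =>
    change fderiv ℝ (fun x => mink n (P (k + 1) x) (G x) + pairQuot P G m k x / m) x e = _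
    rw [fderiv_fun_add (((hP (k + 1)).mink hG).differentiable (by simp) x)
      (((contDiff_pairQuot hP hG m k).div_const m).differentiable (by simp) x)]
    simp only [div_eq_mul_inv]
    rw [fderiv_mul_const ((contDiff_pairQuot hP hG m k).differentiable (by simp) x)]
    simp only [_root_.add_apply, _root_.smul_apply, ih]
    rw [fderiv_mink (hP (k + 1)) hG, h.succ, hGpar, mink_neg_right, mink_smul_right, mink_neg_left,
      mink_wedge_left n (F x) (W x) (P (k + 1) x) (G x), smul_eq_mul]
    field_simp
    ring

/-- The coefficients of the polynomial multiplying `G₁` resp. `G₂` in the conserved quantity of the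
permutability surface. -/
def permutCoeff {n : ℕ} (P : ℕ → Surf → MV n) (G₁ G₂ G : Surf → MV n) (m : ℝ) (k : ℕ)
    (x : Surf) : ℝ :=
  pairQuot P G m k x / mink n (G₁ x) (G₂ x)

/-- The coefficient sequence of `Γ_{⟨G₂⟩}^{⟨G₁⟩}((1 - t/m₁)/(1 - t/m₂)) P(t)`. -/
def permutSeq {n : ℕ} (P : ℕ → Surf → MV n) (G₁ G₂ : Surf → MV n) (m₁ m₂ : ℝ) (k : ℕ) :
    Surf → MV n :=
  P k + shiftSeq (fun j x => ((m₁ - m₂) / (m₁ * m₂)) •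
    (permutCoeff P G₁ G₂ G₂ m₂ j x • G₁ x - permutCoeff P G₁ G₂ G₁ m₁ j x • G₂ x)) k

section Permutability

variable {n : ℕ} {P : ℕ → Surf → MV n} {G₁ G₂ : Surf → MV n} {m₁ m₂ : ℝ}

lemma contDiff_permutCoeff (hP : ∀ k, ContDiff ℝ (⊤ : ℕ∞) (P k))
    (hG₁ : ContDiff ℝ (⊤ : ℕ∞) G₁) (hG₂ : ContDiff ℝ (⊤ : ℕ∞) G₂)
    (hK : ∀ x, mink n (G₁ x) (G₂ x) ≠ 0) {G : Surf → MV n} (hG : ContDiff ℝ (⊤ : ℕ∞) G)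
    (m : ℝ) (k : ℕ) : ContDiff ℝ (⊤ : ℕ∞) (permutCoeff P G₁ G₂ G m k) :=
  (contDiff_pairQuot hP hG m k).div (hG₁.mink hG₂) hK

lemma fderiv_permutCoeff {e : Surf} {F W : Surf → MV n} {G : Surf → MV n} {m : ℝ} (hm : m ≠ 0)
    (hP : ∀ k, ContDiff ℝ (⊤ : ℕ∞) (P k)) (hG₁ : ContDiff ℝ (⊤ : ℕ∞) G₁)
    (hG₂ : ContDiff ℝ (⊤ : ℕ∞) G₂) (hK : ∀ x, mink n (G₁ x) (G₂ x) ≠ 0)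
    (h : ConservedAlong e F W P) (hG : ContDiff ℝ (⊤ : ℕ∞) G)
    (hp₁ : ∀ x, fderiv ℝ G₁ x e = -(m₁ • wedge n (F x) (W x) (G₁ x)))
    (hp₂ : ∀ x, fderiv ℝ G₂ x e = -(m₂ • wedge n (F x) (W x) (G₂ x)))
    (hp : ∀ x, fderiv ℝ G x e = -(m • wedge n (F x) (W x) (G x))) (k : ℕ) (x : Surf) :
    fderiv ℝ (permutCoeff P G₁ G₂ G m k) x e
      = (m * mink n (wedge n (F x) (W x) (P k x)) (G x) - permutCoeff P G₁ G₂ G m k x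
        * ((m₂ - m₁) * mink n (wedge n (F x) (W x) (G₁ x)) (G₂ x))) / mink n (G₁ x) (G₂ x) := by
  have heq : pairQuot P G m k
      = fun x => permutCoeff P G₁ G₂ G m k x * mink n (G₁ x) (G₂ x) := by
    funext y
    rw [permutCoeff, div_mul_cancel₀ _ (hK y)]
  have hd := fderiv_pairQuot hm hP hG h hp k x
  rw [heq, fderiv_fun_mul
    ((contDiff_permutCoeff hP hG₁ hG₂ hK hG m k).differentiable (by simp) x)
    ((hG₁.mink hG₂).differentiable (by simp) x)] at hd
  simp only [_root_.add_apply, _root_.smul_apply, smul_eq_mul] at hd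
  rw [fderiv_mink hG₁ hG₂, hp₁, hp₂, mink_neg_left, mink_neg_right, mink_smul_left,
    mink_smul_right, ← neg_eq_iff_eq_neg.2 (mink_wedge_left n (F x) (W x) (G₁ x) (G₂ x))] at hd
  rw [eq_div_iff (hK x), ← hd]
  ring

lemma permutCoeff_shift (hm : m₂ ≠ 0) (k : ℕ) (G : Surf → MV n) (x : Surf) :
    shiftSeq (fun j => permutCoeff P G₁ G₂ G m₂ j x) k
      = m₂ * (permutCoeff P G₁ G₂ G m₂ k x
        - mink n (P k x) (G x) / mink n (G₁ x) (G₂ x)) := by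
  rcases k with _ | k
  · simp [permutCoeff, pairQuot, quotSeq]
  · simp only [shiftSeq_succ, permutCoeff, pairQuot, quotSeq]
    field_simp
    ring

lemma permutSeq_apply (hm₁ : m₁ ≠ 0) (hm₂ : m₂ ≠ 0) (k : ℕ) (x : Surf) :
    permutSeq P G₁ G₂ m₁ m₂ k x = P k x + ((m₁ - m₂) / (m₁ * m₂)) •
      ((m₂ * (permutCoeff P G₁ G₂ G₂ m₂ k x
          - mink n (P k x) (G₂ x) / mink n (G₁ x) (G₂ x))) • G₁ x
        - (m₁ * (permutCoeff P G₁ G₂ G₁ m₁ k x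
          - mink n (P k x) (G₁ x) / mink n (G₁ x) (G₂ x))) • G₂ x) := by
  rw [← permutCoeff_shift hm₁, ← permutCoeff_shift hm₂]
  rcases k with _ | k
  · simp [permutSeq]
  · simp [permutSeq]

lemma permutSeq_eq_gaugeG (hm₁ : m₁ ≠ 0) (hm₂ : m₂ ≠ 0) (k : ℕ) (x : Surf)
    (h₁ : mink n (G₁ x) (G₁ x) = 0) (h₂ : mink n (G₂ x) (G₂ x) = 0)
    (hK : mink n (G₁ x) (G₂ x) ≠ 0) :
    permutSeq P G₁ G₂ m₁ m₂ k x = gaugeG n (G₂ x) (G₁ x) (m₂ / m₁)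
      (P k x + ((m₁ - m₂) / m₂ * permutCoeff P G₁ G₂ G₂ m₂ k x) • G₁ x
        + ((m₂ - m₁) / m₁ * permutCoeff P G₁ G₂ G₁ m₁ k x) • G₂ x) := by
  rw [permutSeq_apply hm₁ hm₂]
  simp only [gaugeG, mink_add_right, mink_smul_right, h₁, h₂, mink_comm n (G₂ x) (G₁ x),
    mink_comm n (P k x)]
  match_scalars <;> field_simp <;> ring

/-- The sequence `permutSeq P G₁ G₂ m₁ m₂` is conserved by the connections with
`η̂ = Ad(Γ_{⟨G₂⟩}^{⟨G₁⟩}(m₂/m₁)) η`. -/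
lemma ConservedAlong.permutSeq {e : Surf} {F W F' W' : Surf → MV n} (h : ConservedAlong e F W P)
    (hm₁ : m₁ ≠ 0) (hm₂ : m₂ ≠ 0) (hP : ∀ k, ContDiff ℝ (⊤ : ℕ∞) (P k))
    (hG₁ : ContDiff ℝ (⊤ : ℕ∞) G₁) (hG₂ : ContDiff ℝ (⊤ : ℕ∞) G₂)
    (hn₁ : ∀ x, mink n (G₁ x) (G₁ x) = 0) (hn₂ : ∀ x, mink n (G₂ x) (G₂ x) = 0)
    (hK : ∀ x, mink n (G₁ x) (G₂ x) ≠ 0)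
    (hp₁ : ∀ x, fderiv ℝ G₁ x e + m₁ • wedge n (F x) (W x) (G₁ x) = 0)
    (hp₂ : ∀ x, fderiv ℝ G₂ x e + m₂ • wedge n (F x) (W x) (G₂ x) = 0)
    (hT : ∀ x z, wedge n (F' x) (W' x) (gaugeG n (G₂ x) (G₁ x) (m₂ / m₁) z)
      = gaugeG n (G₂ x) (G₁ x) (m₂ / m₁) (wedge n (F x) (W x) z)) :
    ConservedAlong e F' W' (permutSeq P G₁ G₂ m₁ m₂) := by
  replace hp₁ := fun x => eq_neg_of_add_eq_zero_left (hp₁ x)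
  replace hp₂ := fun x => eq_neg_of_add_eq_zero_left (hp₂ x)
  refine ⟨fun x => ?_, fun k x => ?_⟩
  · simpa [_root_.permutSeq] using h.zero x
  · rw [permutSeq_eq_gaugeG hm₁ hm₂ k x (hn₁ x) (hn₂ x) (hK x), hT]
    have hu₁ := contDiff_permutCoeff hP hG₁ hG₂ hK hG₂ m₂ k
    have hu₂ := contDiff_permutCoeff hP hG₁ hG₂ hK hG₁ m₁ k
    have hs₁ : ContDiff ℝ (⊤ : ℕ∞) fun x => permutCoeff P G₁ G₂ G₂ m₂ k x • G₁ x := hu₁.smul hG₁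
    have hs₂ : ContDiff ℝ (⊤ : ℕ∞) fun x => permutCoeff P G₁ G₂ G₁ m₁ k x • G₂ x := hu₂.smul hG₂
    change fderiv ℝ (fun x => P (k + 1) x + ((m₁ - m₂) / (m₁ * m₂)) •
      (permutCoeff P G₁ G₂ G₂ m₂ k x • G₁ x - permutCoeff P G₁ G₂ G₁ m₁ k x • G₂ x)) x e = _
    rw [fderiv_add_apply (hP (k + 1)) ((hs₁.sub hs₂).const_smul _),
      fderiv_const_smul_apply _ (hs₁.sub hs₂), fderiv_sub_apply hs₁ hs₂,
      fderiv_smul_apply hu₁ hG₁, fderiv_smul_apply hu₂ hG₂, h.succ,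
      fderiv_permutCoeff hm₂ hP hG₁ hG₂ hK h hG₂ hp₁ hp₂ hp₂,
      fderiv_permutCoeff hm₁ hP hG₁ hG₂ hK h hG₁ hp₁ hp₂ hp₁, hp₁, hp₂]
    have hs : mink n (wedge n (F x) (W x) (G₂ x)) (G₁ x)
        = -mink n (wedge n (F x) (W x) (G₁ x)) (G₂ x) := by
      rw [mink_wedge_left, mink_comm]
    have hKx := hK x
    simp only [wedge_add, wedge_smul, gaugeG, mink_add_right, mink_smul_right,
      mink_comm n (G₁ x) (wedge _ _ _ _), mink_comm n (G₂ x) (wedge _ _ _ _), hs, mink_wedge_self,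
      mink_comm n (G₂ x) (G₁ x)]
    generalize wedge n (F x) (W x) (G₁ x) = E₁ at *
    generalize wedge n (F x) (W x) (G₂ x) = E₂ at *
    match_scalars <;> field_simp <;> ring

lemma permutCoeff_eq_zero {m : ℝ} (hm : m ≠ 0) {d : ℕ} (hP : ∀ k, d < k → P k = 0)
    (G : Surf → MV n)
    (hroot : ∀ x, mink n (∑ k ∈ range (d + 1), m ^ k • P k x) (G x) = 0) {k : ℕ} (hk : d ≤ k)
    (x : Surf) : permutCoeff P G₁ G₂ G m k x = 0 := by
  have h0 : quotSeq m (fun j => mink n (P j x) (G x)) k = 0 := by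
    refine quotSeq_eq_zero hm (d := d) (fun k hk => ?_) ?_ hk
    · simp [hP k hk, mink_zero_left]
    · simpa only [mink_sum_left, mink_smul_left] using hroot x
  rw [permutCoeff, pairQuot, h0, zero_div]

lemma mink_sum_eq_permutCoeff {m : ℝ} (hm : m ≠ 0) {d : ℕ} (hP : ∀ k, d < k → P k = 0)
    (hK : ∀ x, mink n (G₁ x) (G₂ x) ≠ 0) (G : Surf → MV n)
    (hroot : ∀ x, mink n (∑ k ∈ range (d + 1), m ^ k • P k x) (G x) = 0) (t : ℝ) (x : Surf) :
    mink n (∑ k ∈ range (d + 1), t ^ k • P k x) (G x)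
      = (1 - t / m) * mink n (G₁ x) (G₂ x)
        * ∑ k ∈ range (d + 1), t ^ k • permutCoeff P G₁ G₂ G m k x := by
  have h0 : quotSeq m (fun j => mink n (P j x) (G x)) d = 0 := by
    refine quotSeq_eq_zero hm (d := d) (fun k hk => ?_) ?_ le_rfl
    · simp [hP k hk, mink_zero_left]
    · simpa only [mink_sum_left, mink_smul_left] using hroot x
  simp only [mink_sum_left, mink_smul_left]
  rw [sum_pow_mul_quotSeq m, h0, mul_assoc, Finset.mul_sum _ _ (mink n (G₁ x) (G₂ x))]
  simp only [mul_zero, zero_div, add_zero]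
  congr 1
  refine Finset.sum_congr rfl fun k _ => ?_
  rw [permutCoeff, pairQuot, smul_eq_mul]
  field_simp [hK x]

lemma sum_permutSeq {d : ℕ} (hu₁ : ∀ x, permutCoeff P G₁ G₂ G₂ m₂ d x = 0)
    (hu₂ : ∀ x, permutCoeff P G₁ G₂ G₁ m₁ d x = 0) (t : ℝ) (x : Surf) :
    ∑ k ∈ range (d + 1), t ^ k • permutSeq P G₁ G₂ m₁ m₂ k x
      = (∑ k ∈ range (d + 1), t ^ k • P k x) + (t * ((m₁ - m₂) / (m₁ * m₂))) •
        ((∑ k ∈ range (d + 1), t ^ k • permutCoeff P G₁ G₂ G₂ m₂ k x) • G₁ x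
          - (∑ k ∈ range (d + 1), t ^ k • permutCoeff P G₁ G₂ G₁ m₁ k x) • G₂ x) := by
  have h : ∑ k ∈ range (d + 1), t ^ k • permutSeq P G₁ G₂ m₁ m₂ k
      = (∑ k ∈ range (d + 1), t ^ k • P k) + t • ∑ k ∈ range d, t ^ k • fun x =>
        ((m₁ - m₂) / (m₁ * m₂)) • (permutCoeff P G₁ G₂ G₂ m₂ k x • G₁ x
          - permutCoeff P G₁ G₂ G₁ m₁ k x • G₂ x) := by
    simp only [permutSeq, smul_add, Finset.sum_add_distrib]
    rw [sum_shiftSeq]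
  have hx := congrFun h x
  simp only [Finset.sum_apply, Pi.add_apply, Pi.smul_apply] at hx
  rw [hx, Finset.sum_range_succ (fun k => t ^ k • permutCoeff P G₁ G₂ G₂ m₂ k x),
    Finset.sum_range_succ (fun k => t ^ k • permutCoeff P G₁ G₂ G₁ m₁ k x), hu₁, hu₂]
  simp only [smul_zero, add_zero, Finset.sum_smul, ← Finset.sum_sub_distrib, Finset.smul_sum,
    smul_assoc, mul_smul, smul_sub]
  congr 1
  refine Finset.sum_congr rfl fun k _ => ?_
  simp only [smul_comm (t ^ k)]

end Permutability

/-- Corollary: in `S³`, if `(Λ,η)` is special isothermic of type `d` but not of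
type `d−1` and both Darboux transforms `(Λ₁,η₁)`, `(Λ₂,η₂)` are special
isothermic of type `d` with `p₁(0) = p₂(0) = p(0)`, then the Bianchi
permutability fourth surface is special isothermic of type `d` with
`p̂(0) = p(0)` and `(p̂(t),p̂(t)) = (p(t),p(t))`. -/
theorem bianchi_permutability_special_S3 (d : ℕ) (hd : 1 ≤ d)
    (S : IsothermicSurface 3) (p : PolyConservedQuantity 3 S d)
    (hnot : ¬ SpecialOfType 3 S (d - 1))
    (m₁ m₂ : ℝ) (hm₁ : m₁ ≠ 0) (hm₂ : m₂ ≠ 0) (hne : m₁ ≠ m₂)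
    (D₁ : DarbouxTransform 3 S m₁) (D₂ : DarbouxTransform 3 S m₂)
    (hdisj : ∀ x, D₁.G x ∉ Submodule.span ℝ {D₂.G x})
    (T₁ : IsothermicSurface 3) (hT₁ : T₁.F = D₁.G) (hg₁ : GaugeRel 3 S T₁ m₁)
    (T₂ : IsothermicSurface 3) (hT₂ : T₂.F = D₂.G) (hg₂ : GaugeRel 3 S T₂ m₂)
    (p₁ : PolyConservedQuantity 3 T₁ d) (h₁0 : ∀ x, p₁.coeff 0 x = p.coeff 0 x)
    (p₂ : PolyConservedQuantity 3 T₂ d) (h₂0 : ∀ x, p₂.coeff 0 x = p.coeff 0 x)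
    (T : IsothermicSurface 3)
    (hT : IsPermutabilityFourth 3 S m₁ m₂ D₁ D₂ T) :
    ∃ ph : PolyConservedQuantity 3 T d,
      (∀ x, ph.coeff 0 x = p.coeff 0 x)
      ∧ ∀ t x, mink 3 (pcEval ph t x) (pcEval ph t x)
          = mink 3 (pcEval p t x) (pcEval p t x) := by
  have hK : ∀ x, mink 3 (D₁.G x) (D₂.G x) ≠ 0 := fun x => by
    rw [mink_comm]
    exact mink_ne_zero_of_null 3 (D₂.G_ne x) (D₂.G_null x) (D₁.G_null x) (hdisj x)
  have hroot₁ := mink_pcEval_darboux_eq_zero hd p hnot hm₁ D₁ hT₁ hg₁ p₁ h₁0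
  have hroot₂ := mink_pcEval_darboux_eq_zero hd p hnot hm₂ D₂ hT₂ hg₂ p₂ h₂0
  have hP := p.isConserved
  have hu₁ : ∀ k, d ≤ k → ∀ x, permutCoeff p.coeff D₁.G D₂.G D₂.G m₂ k x = 0 := fun k hk =>
    permutCoeff_eq_zero hm₂ p.coeff_eq_zero D₂.G hroot₂ hk
  have hu₂ : ∀ k, d ≤ k → ∀ x, permutCoeff p.coeff D₁.G D₂.G D₁.G m₁ k x = 0 := fun k hk =>
    permutCoeff_eq_zero hm₁ p.coeff_eq_zero D₁.G hroot₁ hk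
  have hcons : IsConserved T (permutSeq p.coeff D₁.G D₂.G m₁ m₂) := by
    refine ⟨fun k => (p.smooth k).add (contDiff_shiftSeq (fun j => ?_) k), ?_, ?_⟩
    · exact (((contDiff_permutCoeff p.smooth D₁.smooth_G D₂.smooth_G hK D₂.smooth_G m₂ j).smul
        D₁.smooth_G).sub ((contDiff_permutCoeff p.smooth D₁.smooth_G D₂.smooth_G hK D₁.smooth_G
        m₁ j).smul D₂.smooth_G)).const_smul _
    · exact hP.along_du.permutSeq hm₁ hm₂ p.smooth D₁.smooth_G D₂.smooth_G D₁.G_null D₂.G_null hK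
        (fun x => (D₁.parallel x).1) (fun x => (D₂.parallel x).1) hT.2.1
    · exact hP.along_dv.permutSeq hm₁ hm₂ p.smooth D₁.smooth_G D₂.smooth_G D₁.G_null D₂.G_null hK
        (fun x => (D₁.parallel x).2) (fun x => (D₂.parallel x).2) hT.2.2
  have hdeg : ∀ k, d < k → permutSeq p.coeff D₁.G D₂.G m₁ m₂ k = 0 := by
    intro k hk
    obtain ⟨k, rfl⟩ : ∃ j, k = j + 1 := ⟨k - 1, by omega⟩
    funext x
    simp [permutSeq, p.coeff_eq_zero _ hk, hu₁ k (by omega), hu₂ k (by omega)]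
  have htop : permutSeq p.coeff D₁.G D₂.G m₁ m₂ d ≠ 0 := by
    intro h0
    apply p.top_ne
    funext x
    have hx := congrFun h0 x
    rw [permutSeq_eq_gaugeG hm₁ hm₂ d x (D₁.G_null x) (D₂.G_null x) (hK x), hu₁ d le_rfl,
      hu₂ d le_rfl] at hx
    have := eq_zero_of_gaugeG_eq_zero (D₂.G_null x) (D₁.G_null x)
      (by rw [mink_comm]; exact hK x) (div_ne_zero hm₂ hm₁) hx
    simpa using this
  refine ⟨hcons.toPolyConservedQuantity hdeg htop, fun x => ?_, fun t x => ?_⟩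
  · simp [IsConserved.toPolyConservedQuantity, permutSeq]
  · simp only [pcEval, IsConserved.toPolyConservedQuantity]
    have h₁ := mink_sum_eq_permutCoeff (G₁ := D₁.G) (G₂ := D₂.G) hm₁ p.coeff_eq_zero hK D₁.G
      hroot₁ t x
    have h₂ := mink_sum_eq_permutCoeff (G₁ := D₁.G) (G₂ := D₂.G) hm₂ p.coeff_eq_zero hK D₂.G
      hroot₂ t x
    rw [sum_permutSeq (hu₁ d le_rfl) (hu₂ d le_rfl)]
    generalize (∑ k ∈ range (d + 1), t ^ k • p.coeff k x) = s at *
    simp only [mink_add_left, mink_add_right, mink_sub_left, mink_sub_right, mink_smul_left,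
      mink_smul_right, D₁.G_null, D₂.G_null, mink_comm 3 (D₂.G x) (D₁.G x),
      mink_comm 3 (D₁.G x) s, mink_comm 3 (D₂.G x) s, h₁, h₂]
    field_simp
    ring
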